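/- arXiv:2003.07511 — 2 statements merged into one kernel-verified Lean document; each statement's English description precedes it below -/
import Mathlib

section
/- Let S be a Seidel matrix of order n ≥ 277 with smallest eigenvalue exactly −5, such that the clique number ω([S]) of the switching class of S equals 4. If the independence number α([S]) of the switching class of S satisfies α([S]) ≥ 29, then rk(S + 5I) ≥ 2n/3 + 1. -/
open Matrix

/-- A Seidel matrix: symmetric, zero diagonal, off-diagonal entries `±1`. -/
def IsSeidel {n : ℕ} (S : Matrix (Fin n) (Fin n) ℝ) : Prop :=
  S.IsSymm ∧ (∀ i, S i i = 0) ∧ ∀ i j, i ≠ j → S i j = 1 ∨ S i j = -1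

/-- Smallest eigenvalue of a real symmetric matrix (junk value `0` if not Hermitian). -/
noncomputable def minEig {m : Type*} [Fintype m] [DecidableEq m] (A : Matrix m m ℝ) : ℝ := by
  classical
  exact if hA : A.IsHermitian then ⨅ i, hA.eigenvalues i else 0

/-- Largest eigenvalue of a real symmetric matrix (junk value `0` if not Hermitian). -/
noncomputable def maxEig {m : Type*} [Fintype m] [DecidableEq m] (A : Matrix m m ℝ) : ℝ := by
  classical
  exact if hA : A.IsHermitian then ⨆ i, hA.eigenvalues i else 0

/-- The Seidel matrix of a simple graph `G`, i.e. `J - I - 2A(G)`: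
zero diagonal, `-1` on adjacent pairs, `1` on distinct non-adjacent pairs. -/
noncomputable def seidelOf {V : Type*} [Fintype V] (G : SimpleGraph V) : Matrix V V ℝ := by
  classical
  exact Matrix.of fun i j => if i = j then 0 else if G.Adj i j then -1 else 1

/-- Smallest eigenvalue of the Seidel matrix of a finite graph. -/
noncomputable def minSeidelEig {V : Type*} [Finite V] (G : SimpleGraph V) : ℝ := by
  classical
  letI := Fintype.ofFinite V
  exact minEig (seidelOf G)

/-- Spectral radius (largest adjacency eigenvalue) of a finite graph. -/
noncomputable def specRad {V : Type*} [Finite V] (G : SimpleGraph V) : ℝ := by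
  classical
  letI := Fintype.ofFinite V
  exact maxEig (G.adjMatrix ℝ)

/-- Switching equivalence: `T = D S D` for some diagonal `±1` matrix `D`. -/
def SwEquiv {n : ℕ} (S T : Matrix (Fin n) (Fin n) ℝ) : Prop :=
  ∃ ε : Fin n → ℝ, (∀ i, ε i = 1 ∨ ε i = -1) ∧
    T = Matrix.diagonal ε * S * Matrix.diagonal ε

/-- The switching graph of a Seidel matrix `S`: the graph on `2n` vertices whose Seidel
matrix is the block matrix `((S, I - S), (I - S, S))`, adjacency given by entries `-1`. -/
def switchGraph {n : ℕ} (S : Matrix (Fin n) (Fin n) ℝ) : SimpleGraph (Fin n ⊕ Fin n) :=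
  SimpleGraph.fromRel fun x y => Matrix.fromBlocks S (1 - S) (1 - S) S x y = -1

/-- Independence number of a graph. -/
noncomputable def indepNum {V : Type*} (G : SimpleGraph V) : ℕ := Gᶜ.cliqueNum

/-- The graph consisting of `t` disjoint copies of `K₂`. -/
def nK2 (t : ℕ) : SimpleGraph (Fin t × Fin 2) :=
  SimpleGraph.fromRel fun p q => p.1 = q.1

set_option linter.unusedSectionVars false

section helpers
open scoped Classical

variable {V : Type} [Fintype V]

noncomputable def aG (G : SimpleGraph V) (i j : V) : ℝ := if G.Adj i j then 1 else 0

lemma aG_symm (G : SimpleGraph V) (i j : V) : aG G i j = aG G j i := by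
  unfold aG; simp [G.adj_comm]

lemma aG_self (G : SimpleGraph V) (i : V) : aG G i i = 0 := by simp [aG]

lemma aG_nonneg (G : SimpleGraph V) (i j : V) : 0 ≤ aG G i j := by
  unfold aG; split_ifs <;> norm_num

lemma aG_le_one (G : SimpleGraph V) (i j : V) : aG G i j ≤ 1 := by
  unfold aG; split_ifs <;> norm_num

lemma aG_sq (G : SimpleGraph V) (i j : V) : aG G i j * aG G i j = aG G i j := by
  unfold aG; split_ifs <;> norm_num

noncomputable def Qf (G : SimpleGraph V) (x y : V → ℝ) : ℝ :=
  4 * ∑ i, x i * y i - 2 * ∑ i, ∑ j, aG G i j * x i * y j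

noncomputable def QV (G : SimpleGraph V) (h : V → ℝ) (i : V) : ℝ :=
  4 * h i - 2 * ∑ j, aG G i j * h j

lemma Qf_symm (G : SimpleGraph V) (x y : V → ℝ) : Qf G x y = Qf G y x := by
  unfold Qf
  congr 2
  · exact Finset.sum_congr rfl fun i _ => mul_comm _ _
  · rw [Finset.sum_comm]
    refine Finset.sum_congr rfl fun i _ => Finset.sum_congr rfl fun j _ => ?_
    rw [aG_symm G j i]; ring

lemma Qf_eq_QV (G : SimpleGraph V) (x h : V → ℝ) : Qf G x h = ∑ i, x i * QV G h i := by
  unfold Qf QV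
  rw [Finset.mul_sum, Finset.mul_sum, ← Finset.sum_sub_distrib]
  refine Finset.sum_congr rfl fun i _ => ?_
  rw [mul_sub, Finset.mul_sum, Finset.mul_sum, Finset.mul_sum]
  congr 1
  · ring
  · exact Finset.sum_congr rfl fun j _ => by ring

lemma Qf_add_left (G : SimpleGraph V) (x y z : V → ℝ) : Qf G (x + y) z = Qf G x z + Qf G y z := by
  simp only [Qf_eq_QV, Pi.add_apply, add_mul, Finset.sum_add_distrib]

lemma Qf_smul_left (G : SimpleGraph V) (c : ℝ) (x z : V → ℝ) : Qf G (c • x) z = c * Qf G x z := by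
  simp only [Qf_eq_QV, Pi.smul_apply, smul_eq_mul, mul_assoc, Finset.mul_sum]

lemma Qf_add_right (G : SimpleGraph V) (x y z : V → ℝ) : Qf G z (x + y) = Qf G z x + Qf G z y := by
  rw [Qf_symm, Qf_add_left, Qf_symm G x, Qf_symm G y]

lemma Qf_smul_right (G : SimpleGraph V) (c : ℝ) (x z : V → ℝ) : Qf G z (c • x) = c * Qf G z x := by
  rw [Qf_symm, Qf_smul_left, Qf_symm G x]

lemma Qf_abs_le (G : SimpleGraph V) (x : V → ℝ) : Qf G |x| |x| ≤ Qf G x x := by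
  unfold Qf
  have h1 : ∑ i, |x| i * |x| i = ∑ i, x i * x i :=
    Finset.sum_congr rfl fun i _ => by simp [Pi.abs_apply]
  rw [h1]
  have h2 : ∑ i, ∑ j, aG G i j * x i * x j ≤ ∑ i, ∑ j, aG G i j * |x| i * |x| j := by
    refine Finset.sum_le_sum fun i _ => Finset.sum_le_sum fun j _ => ?_
    simp only [Pi.abs_apply]
    rw [mul_assoc, mul_assoc, ← abs_mul]
    exact mul_le_mul_of_nonneg_left (le_abs_self _) (aG_nonneg _ _ _)
  linarith

/-- `J + 4I - 2A` is positive semidefinite. -/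
def PSDM (G : SimpleGraph V) : Prop := ∀ x : V → ℝ, 0 ≤ (∑ i, x i) ^ 2 + Qf G x x

/-- A good test vector. -/
def Good (G : SimpleGraph V) : Prop :=
  ∃ h : V → ℝ, (∀ i, 0 ≤ h i) ∧ Qf G h h < 0 ∧
    (Finset.univ.filter fun i => QV G h i ≠ 0).card ≤ 91

noncomputable def tt (G : SimpleGraph V) (U : Finset V) (y z : V) : ℝ := ∑ u ∈ U, aG G u y * aG G u z

noncomputable def kk (G : SimpleGraph V) (U : Finset V) (y : V) : ℝ := ∑ u ∈ U, aG G u y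

noncomputable def BB (G : SimpleGraph V) (U : Finset V) (y z : V) : ℝ :=
  tt G U y z + 2 * aG G y z - if y = z then 4 else 0

lemma tt_symm (G : SimpleGraph V) (U : Finset V) (y z : V) : tt G U y z = tt G U z y :=
  Finset.sum_congr rfl fun _ _ => mul_comm _ _

lemma BB_symm (G : SimpleGraph V) (U : Finset V) (y z : V) : BB G U y z = BB G U z y := by
  unfold BB; rw [tt_symm, aG_symm]; simp [eq_comm]

lemma tt_nonneg (G : SimpleGraph V) (U : Finset V) (y z : V) : 0 ≤ tt G U y z :=
  Finset.sum_nonneg fun _ _ => mul_nonneg (aG_nonneg _ _ _) (aG_nonneg _ _ _)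

lemma tt_self (G : SimpleGraph V) (U : Finset V) (y : V) : tt G U y y = kk G U y :=
  Finset.sum_congr rfl fun _ _ => aG_sq _ _ _

lemma BB_self (G : SimpleGraph V) (U : Finset V) (y : V) : BB G U y y = kk G U y - 4 := by
  unfold BB; rw [tt_self, aG_self]; simp

lemma kk_nonneg (G : SimpleGraph V) (U : Finset V) (y : V) : 0 ≤ kk G U y :=
  Finset.sum_nonneg fun _ _ => aG_nonneg _ _ _

theorem starIneq (G : SimpleGraph V) (hM : PSDM G) (U : Finset V) (hU : U.card = 29)
    (hI : ∀ u ∈ U, ∀ v ∈ U, ¬ G.Adj u v) (f : V → ℝ) (hf : ∀ u ∈ U, f u = 0) :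
    ∑ y, ∑ z, f y * f z * BB G U y z ≤ (∑ y, f y * (kk G U y + 2)) ^ 2 / 33 := by
  set c : V → ℝ := fun u => ∑ y, aG G u y * f y with hc
  set σ := ∑ y, f y * (kk G U y + 2) with hσ
  set c0 := σ / 33 with hc0
  set e : V → ℝ := fun i => if i ∈ U then c i - c0 else 0 with he
  have h1 := hM ((2:ℝ) • f + e)
  rw [Qf_add_left, Qf_add_right, Qf_add_right, Qf_symm G e, Qf_smul_left, Qf_smul_left,
    Qf_smul_right] at h1
  have hee : Qf G e e = 4 * ∑ u ∈ U, (c u - c0) ^ 2 := by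
    unfold Qf
    have : ∑ i, ∑ j, aG G i j * e i * e j = 0 := by
      refine Finset.sum_eq_zero fun i _ => Finset.sum_eq_zero fun j _ => ?_
      simp only [he]
      by_cases hi : i ∈ U
      · by_cases hj : j ∈ U
        · simp [aG, hI i hi j hj]
        · simp [hj]
      · simp [hi]
    rw [this]
    have : ∑ i, e i * e i = ∑ u ∈ U, (c u - c0) ^ 2 := by
      simp only [he]
      rw [← Finset.sum_filter_add_sum_filter_not Finset.univ (fun i => i ∈ U)]
      rw [Finset.sum_congr rfl (g := fun i => (c i - c0)^2)]
      · rw [Finset.sum_eq_zero (s := Finset.univ.filter fun i => ¬ i ∈ U)]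
        · simp
        · intro i hi
          simp at hi; simp [hi]
      · intro i hi
        simp at hi; simp [hi, sq]
    rw [this]; ring
  have hfe : Qf G f e = - 2 * ∑ u ∈ U, (c u - c0) * c u := by
    rw [Qf_symm]
    unfold Qf
    have h0 : ∑ i, e i * f i = 0 := by
      refine Finset.sum_eq_zero fun i _ => ?_
      simp only [he]
      by_cases hi : i ∈ U
      · simp [hf i hi]
      · simp [hi]
    rw [h0]
    have : ∑ i, ∑ j, aG G i j * e i * f j = ∑ i, e i * c i := by
      refine Finset.sum_congr rfl fun i _ => ?_
      rw [hc, Finset.mul_sum]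
      exact Finset.sum_congr rfl fun j _ => by ring
    rw [this]
    have : ∑ i, e i * c i = ∑ u ∈ U, (c u - c0) * c u := by
      simp only [he, ite_mul, zero_mul]
      rw [← Finset.sum_filter]; simp
    rw [this]; ring
  have hsum : ∑ i, ((2:ℝ) • f + e) i = 2 * ∑ i, f i + ∑ u ∈ U, (c u - c0) := by
    simp only [Pi.add_apply, Pi.smul_apply, smul_eq_mul, Finset.sum_add_distrib, Finset.mul_sum, he]
    rw [← Finset.sum_filter]; simp
  have hsc : ∑ u ∈ U, c u = ∑ y, f y * kk G U y := by
    simp only [hc, kk]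
    rw [Finset.sum_comm]
    refine Finset.sum_congr rfl fun y _ => ?_
    rw [Finset.mul_sum]; exact Finset.sum_congr rfl fun u _ => by ring
  have hscc : ∑ u ∈ U, c u * c u = ∑ y, ∑ z, f y * f z * tt G U y z := by
    simp only [hc, tt, Finset.sum_mul_sum]
    rw [Finset.sum_comm]
    refine Finset.sum_congr rfl fun y _ => ?_
    rw [Finset.sum_comm]
    refine Finset.sum_congr rfl fun z _ => ?_
    rw [Finset.mul_sum]
    exact Finset.sum_congr rfl fun u _ => by ring
  have hσ2 : σ = ∑ u ∈ U, c u + 2 * ∑ i, f i := by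
    rw [hsc, hσ, Finset.mul_sum, ← Finset.sum_add_distrib]
    exact Finset.sum_congr rfl fun y _ => by ring
  have hB : ∑ y, ∑ z, f y * f z * BB G U y z = ∑ u ∈ U, c u * c u - Qf G f f := by
    rw [hscc]
    unfold Qf BB
    rw [Finset.mul_sum, Finset.mul_sum, ← Finset.sum_sub_distrib, ← Finset.sum_sub_distrib]
    refine Finset.sum_congr rfl fun y _ => ?_
    have : f y * f y = ∑ z, if y = z then f y * f z else 0 := by simp
    rw [this, Finset.mul_sum, Finset.mul_sum, ← Finset.sum_sub_distrib, ← Finset.sum_sub_distrib]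
    refine Finset.sum_congr rfl fun z _ => ?_
    split_ifs <;> ring
  rw [hB]
  rw [hee, hfe, hsum] at h1
  have e1 : ∑ u ∈ U, (c u - c0) = ∑ u ∈ U, c u - 29 * c0 := by
    rw [Finset.sum_sub_distrib]; simp [hU]
  have e2 : ∑ u ∈ U, (c u - c0) * c u = ∑ u ∈ U, c u * c u - c0 * ∑ u ∈ U, c u := by
    rw [Finset.mul_sum, ← Finset.sum_sub_distrib]
    exact Finset.sum_congr rfl fun y _ => by ring
  have e3 : ∑ u ∈ U, (c u - c0)^2 = ∑ u ∈ U, c u * c u - 2 * c0 * ∑ u ∈ U, c u + 29 * c0 ^ 2 := by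
    have : (29:ℝ) * c0^2 = ∑ u ∈ U, c0^2 := by simp [hU]
    rw [this, Finset.mul_sum, ← Finset.sum_sub_distrib, ← Finset.sum_add_distrib]
    exact Finset.sum_congr rfl fun y _ => by ring
  rw [e1, e2, e3] at h1
  have hs3 : σ = 33 * c0 := by rw [hc0]; ring
  have : 2 * ∑ i, f i = 33 * c0 - ∑ u ∈ U, c u := by linarith
  rw [this] at h1
  have h33 : σ^2/33 = 33 * c0^2 := by rw [hs3]; ring
  rw [h33]
  nlinarith [h1]

end helpers

section helpers
open scoped Classical

variable {V : Type} [Fintype V]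

lemma sum_f3 (W : Finset V) (z y : V) (a b : ℝ) (g : V → ℝ) :
    ∑ i, ((if i ∈ W then 1 else 0) + a * (if i = z then 1 else 0) + b * (if i = y then 1 else 0)) * g i
      = ∑ i ∈ W, g i + a * g z + b * g y := by
  simp only [add_mul, Finset.sum_add_distrib, mul_assoc, ← Finset.mul_sum, ite_mul, one_mul, zero_mul]
  simp

/-- lower bound data -/
noncomputable def TT (G : SimpleGraph V) (U W : Finset V) : ℝ := ∑ u ∈ U, (∑ w ∈ W, aG G u w) ^ 2

noncomputable def KK (G : SimpleGraph V) (U W : Finset V) : ℝ := ∑ w ∈ W, kk G U w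

lemma KK_eq (G : SimpleGraph V) (U W : Finset V) : KK G U W = ∑ u ∈ U, ∑ w ∈ W, aG G u w := by
  unfold KK kk; exact Finset.sum_comm

lemma KK_nonneg (G : SimpleGraph V) (U W : Finset V) : 0 ≤ KK G U W :=
  Finset.sum_nonneg fun _ _ => kk_nonneg _ _ _

lemma BBsum_ge (G : SimpleGraph V) (U W : Finset V) :
    TT G U W - 4 * W.card ≤ ∑ y ∈ W, ∑ z ∈ W, BB G U y z := by
  have h1 : TT G U W = ∑ y ∈ W, ∑ z ∈ W, tt G U y z := by
    unfold TT tt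
    simp only [sq, Finset.sum_mul_sum]
    rw [Finset.sum_comm]
    exact Finset.sum_congr rfl fun y _ => Finset.sum_comm
  have h2 : (4:ℝ) * W.card = ∑ y ∈ W, ∑ z ∈ W, if y = z then (4:ℝ) else 0 := by
    simp [mul_comm]
  rw [h1, h2, ← Finset.sum_sub_distrib]
  refine Finset.sum_le_sum fun y _ => ?_
  rw [← Finset.sum_sub_distrib]
  refine Finset.sum_le_sum fun z _ => ?_
  unfold BB
  have := aG_nonneg G y z
  linarith

structure Setup (G : SimpleGraph V) (U : Finset V) : Prop where
  hM : PSDM G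
  hU : U.card = 29
  hI : ∀ u ∈ U, ∀ v ∈ U, ¬ G.Adj u v
  hk : ∀ y, y ∉ U → kk G U y ≤ 5

variable {G : SimpleGraph V} {U : Finset V}

theorem star3 (hM : PSDM G) (hU : U.card = 29)
    (hI : ∀ u ∈ U, ∀ v ∈ U, ¬ G.Adj u v) (W : Finset V) (hW : ∀ w ∈ W, w ∉ U) (z y : V) (hz : z ∉ U) (hy : y ∉ U)
    (a b : ℝ) :
    TT G U W - 4 * W.card + 2 * a * ∑ w ∈ W, BB G U z w + 2 * b * ∑ w ∈ W, BB G U y w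
      + a ^ 2 * (kk G U z - 4) + b ^ 2 * (kk G U y - 4) + 2 * a * b * BB G U y z ≤
    (KK G U W + 2 * W.card + a * (kk G U z + 2) + b * (kk G U y + 2)) ^ 2 / 33 := by
  have h := starIneq G hM U hU hI
    (fun i => (if i ∈ W then 1 else 0) + a * (if i = z then 1 else 0) + b * (if i = y then 1 else 0))
    (by
      intro u hu
      have h1 : u ∉ W := fun h => hW u h hu
      have h2 : u ≠ z := fun h => hz (h ▸ hu)
      have h3 : u ≠ y := fun h => hy (h ▸ hu)
      simp [h1, h2, h3])
  have e1 : ∀ g : V → V → ℝ, ∑ p, ∑ q, ((fun i => (if i ∈ W then (1:ℝ) else 0) + a * (if i = z then 1 else 0) + b * (if i = y then 1 else 0)) p) *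
      ((fun i => (if i ∈ W then (1:ℝ) else 0) + a * (if i = z then 1 else 0) + b * (if i = y then 1 else 0)) q) * g p q
      = (∑ p ∈ W, (∑ q ∈ W, g p q + a * g p z + b * g p y)) + a * (∑ q ∈ W, g z q + a * g z z + b * g z y)
       + b * (∑ q ∈ W, g y q + a * g y z + b * g y y) := by
    intro g
    rw [← sum_f3 W z y a b (fun p => ∑ q ∈ W, g p q + a * g p z + b * g p y)]
    refine Finset.sum_congr rfl fun p _ => ?_
    rw [← sum_f3 W z y a b (fun q => g p q), Finset.mul_sum]
    refine Finset.sum_congr rfl fun q _ => ?_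
    ring
  rw [e1, sum_f3] at h
  simp only [Finset.sum_add_distrib, ← Finset.mul_sum, BB_self] at h
  have e2 : ∑ w ∈ W, BB G U w z = ∑ w ∈ W, BB G U z w := Finset.sum_congr rfl fun _ _ => BB_symm _ _ _ _
  have e3 : ∑ w ∈ W, BB G U w y = ∑ w ∈ W, BB G U y w := Finset.sum_congr rfl fun _ _ => BB_symm _ _ _ _
  rw [e2, e3, BB_symm G U z y] at h
  have e4 : ∑ w ∈ W, (2:ℝ) = 2 * W.card := by simp [mul_comm]
  rw [e4] at h
  have := BBsum_ge G U W
  have e5 : KK G U W = ∑ w ∈ W, kk G U w := rfl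
  rw [e5]
  linarith

lemma TT_part (A : Finset V) (W : Finset V) (c : ℝ) (hc : (A.card : ℝ) = c) (hc0 : 0 < c) :
    (∑ u ∈ A, ∑ w ∈ W, aG G u w) ^ 2 / c ≤ ∑ u ∈ A, (∑ w ∈ W, aG G u w) ^ 2 := by
  rw [div_le_iff₀ hc0, ← hc, mul_comm]
  exact sq_sum_le_card_mul_sum_sq

lemma T1 (hU : U.card = 29) (W : Finset V) : (KK G U W) ^ 2 / 29 ≤ TT G U W := by
  rw [KK_eq]
  exact TT_part U W 29 (by simp [hU]) (by norm_num)

lemma T2 (hU : U.card = 29) (W : Finset V) (u : V) (hu : u ∈ U) (hW : ∀ w ∈ W, G.Adj u w) :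
    (W.card : ℝ) ^ 2 + (KK G U W - W.card) ^ 2 / 28 ≤ TT G U W ∧ W.card ≤ KK G U W := by
  have hd : ∑ w ∈ W, aG G u w = W.card := by
    rw [Finset.sum_congr rfl (g := fun _ => (1:ℝ))]
    · simp
    · intro w hw; simp [aG, hW w hw]
  have h1 : KK G U W - W.card = ∑ u ∈ U.erase u, ∑ w ∈ W, aG G u w := by
    rw [KK_eq, ← Finset.add_sum_erase U _ hu, hd]; ring
  have h0 : 0 ≤ KK G U W - W.card := by
    rw [h1]; exact Finset.sum_nonneg fun _ _ => Finset.sum_nonneg fun _ _ => aG_nonneg _ _ _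
  refine ⟨?_, by linarith⟩
  rw [h1]
  unfold TT
  rw [← Finset.add_sum_erase U _ hu, hd]
  have := TT_part (G := G) (U.erase u) W 28 (by simp [hu, hU]) (by norm_num)
  linarith

lemma T3 (hU : U.card = 29) (W : Finset V) (y : V) (hy : kk G U y = 4) :
    (KK G U W - ∑ w ∈ W, tt G U y w) ^ 2 / 25 ≤ TT G U W ∧ ∑ w ∈ W, tt G U y w ≤ KK G U W := by
  set A := U.filter fun u => ¬ G.Adj u y with hA
  have hcA : (A.card : ℝ) = 25 := by
    have h1 : kk G U y = ((U.filter fun u => G.Adj u y).card : ℝ) := by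
      unfold kk aG; rw [← Finset.sum_filter]; simp
    have h2 := Finset.card_filter_add_card_filter_not (s := U) (fun u => G.Adj u y)
    rw [h1] at hy
    have h3 : (U.filter fun u => G.Adj u y).card = 4 := by exact_mod_cast hy
    have : A.card = 25 := by rw [hA]; omega
    simp [this]
  have h1 : KK G U W - ∑ w ∈ W, tt G U y w = ∑ u ∈ A, ∑ w ∈ W, aG G u w := by
    rw [KK_eq]
    unfold tt
    rw [Finset.sum_comm (s := W), ← Finset.sum_sub_distrib, hA, Finset.sum_filter]
    refine Finset.sum_congr rfl fun u _ => ?_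
    rw [← Finset.sum_sub_distrib]
    by_cases h : G.Adj u y
    · simp [aG, h]
    · simp [aG, h]
  have h0 : 0 ≤ KK G U W - ∑ w ∈ W, tt G U y w := by
    rw [h1]; exact Finset.sum_nonneg fun _ _ => Finset.sum_nonneg fun _ _ => aG_nonneg _ _ _
  refine ⟨?_, by linarith⟩
  rw [h1]
  refine (TT_part (G := G) A W 25 hcA (by norm_num)).trans ?_
  unfold TT
  exact Finset.sum_le_sum_of_subset_of_nonneg (Finset.filter_subset _ _) fun _ _ _ => sq_nonneg _

lemma kk_nat (G : SimpleGraph V) (U : Finset V) (y : V) : kk G U y = ((U.filter fun u => G.Adj u y).card : ℝ) := by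
  unfold kk aG; rw [← Finset.sum_filter]; simp

lemma tt_nat (G : SimpleGraph V) (U : Finset V) (y z : V) :
    tt G U y z = ((U.filter fun u => G.Adj u y ∧ G.Adj u z).card : ℝ) := by
  unfold tt aG
  rw [Finset.card_filter]
  push_cast
  refine Finset.sum_congr rfl fun u _ => ?_
  by_cases h1 : G.Adj u y <;> by_cases h2 : G.Adj u z <;> simp [h1, h2]

lemma BB_nat (G : SimpleGraph V) (U : Finset V) {y z : V} (h : y ≠ z) : ∃ m : ℕ, BB G U y z = m := by
  unfold BB
  rw [tt_nat]
  refine ⟨(U.filter fun u => G.Adj u y ∧ G.Adj u z).card + 2 * (if G.Adj y z then 1 else 0), ?_⟩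
  simp [h, aG]

lemma BB_pos_of_adj (G : SimpleGraph V) (U : Finset V) {y z : V} (h : G.Adj y z) : 2 ≤ BB G U y z := by
  unfold BB
  have := tt_nonneg G U y z
  have h1 : aG G y z = 1 := by simp [aG, h]
  simp [h1, h.ne, this]

lemma BB_pos_of_common (G : SimpleGraph V) (U : Finset V) {y z u : V} (hu : u ∈ U) (hyz : y ≠ z)
    (h : G.Adj u y) (h' : G.Adj u z) : 1 ≤ BB G U y z := by
  unfold BB
  have h1 := aG_nonneg G y z
  have h2 : 1 ≤ tt G U y z := by
    rw [tt_nat]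
    have : 0 < (U.filter fun u => G.Adj u y ∧ G.Adj u z).card :=
      Finset.card_pos.mpr ⟨u, by simp [hu, h, h']⟩
    exact_mod_cast this
  simp [hyz]; linarith

lemma BB_pos_cases (G : SimpleGraph V) (U : Finset V) {y z : V} (hyz : y ≠ z) (h : BB G U y z ≠ 0) :
    G.Adj y z ∨ ∃ u ∈ U, G.Adj u y ∧ G.Adj u z := by
  by_contra hc
  push Not at hc
  apply h
  unfold BB
  rw [tt_nat]
  have : (U.filter fun u => G.Adj u y ∧ G.Adj u z) = ∅ := by
    ext u; simp; intro h1 h2; exact hc.2 u h1 h2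
  simp [this, hyz, aG, hc.1]

lemma KK_le (W : Finset V) (c : ℝ) (h : ∀ w ∈ W, kk G U w ≤ c) : KK G U W ≤ c * W.card := by
  unfold KK
  refine (Finset.sum_le_card_nsmul W _ c h).trans ?_
  simp [mul_comm]

/-- pair lemma -/
lemma pair_ineq (hM : PSDM G) (hU : U.card = 29)
    (hI : ∀ u ∈ U, ∀ v ∈ U, ¬ G.Adj u v) (y z : V) (hy : y ∉ U) (hz : z ∉ U) :
    (kk G U y - 4) + (kk G U z - 4) + 2 * BB G U y z ≤ (kk G U y + kk G U z + 4) ^ 2 / 33 := by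
  have h := star3 hM hU hI ∅ (by simp) z y hz hy 1 1
  have h0 : TT G U ∅ = 0 := by simp [TT]
  have h1 : KK G U ∅ = 0 := by simp [KK]
  rw [h0, h1] at h
  simp at h
  have e : kk G U z + 2 + (kk G U y + 2) = kk G U y + kk G U z + 4 := by ring
  rw [e] at h
  linarith

lemma kk_le_five (hM : PSDM G) (hU : U.card = 29)
    (hI : ∀ u ∈ U, ∀ v ∈ U, ¬ G.Adj u v) (y : V) (hy : y ∉ U) (h14 : kk G U y ≤ 14) : kk G U y ≤ 5 := by
  have h := star3 hM hU hI ∅ (by simp) y y hy hy 1 0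
  have h0 : TT G U ∅ = 0 := by simp [TT]
  have h1 : KK G U ∅ = 0 := by simp [KK]
  rw [h0, h1] at h
  simp at h
  have hn := kk_nat G U y
  set m := (U.filter fun u => G.Adj u y).card
  rw [hn] at h h14 ⊢
  have h14' : m ≤ 14 := by exact_mod_cast h14
  by_contra hc
  have hc' : 6 ≤ m := by
    by_contra h6
    apply hc
    have : m ≤ 5 := by omega
    exact_mod_cast this
  interval_cases m <;> norm_num at h

end helpers

section helpers
open scoped Classical

variable {V : Type} [Fintype V] {G : SimpleGraph V} {U : Finset V}

lemma QV_add (x y : V → ℝ) (i : V) : QV G (x + y) i = QV G x i + QV G y i := by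
  unfold QV
  simp only [Pi.add_apply, mul_add, Finset.sum_add_distrib]; ring

lemma QV_smul (c : ℝ) (x : V → ℝ) (i : V) : QV G (c • x) i = c * QV G x i := by
  unfold QV
  have : ∑ j, aG G i j * (c • x) j = c * ∑ j, aG G i j * x j := by
    rw [Finset.mul_sum]; exact Finset.sum_congr rfl fun j _ => by simp; ring
  rw [this]; simp; ring

lemma QV_single (z i : V) : QV G (Pi.single z 1) i = (if i = z then 4 else 0) - 2 * aG G i z := by
  unfold QV
  simp [Pi.single_apply]

/-- basic vector -/
noncomputable def dl (G : SimpleGraph V) (U : Finset V) (y : V) : V → ℝ :=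
  fun i => (if i = y then 2 else 0) + (if i ∈ U then aG G i y else 0)

lemma dl_nonneg (y i : V) : 0 ≤ dl G U y i := by
  unfold dl
  have := aG_nonneg G i y
  split_ifs <;> linarith

lemma QV_dl (hI : ∀ u ∈ U, ∀ v ∈ U, ¬ G.Adj u v) (y : V) (hy : y ∉ U) (i : V) :
    QV G (dl G U y) i = if i ∈ U then 0 else -2 * BB G U y i := by
  have hs : ∑ j, aG G i j * dl G U y j = 2 * aG G i y + ∑ u ∈ U, aG G i u * aG G u y := by
    unfold dl
    simp only [mul_add, Finset.sum_add_distrib]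
    congr 1
    · simp [mul_comm]
    · rw [← Finset.sum_filter_add_sum_filter_not Finset.univ (fun i => i ∈ U)]
      rw [Finset.sum_eq_zero (s := Finset.univ.filter fun i => ¬ i ∈ U)]
      · simp only [Finset.filter_univ_mem, add_zero]
        exact Finset.sum_congr rfl fun u hu => by simp [hu]
      · intro x hx; simp at hx; simp [hx]
  unfold QV
  rw [hs]
  by_cases hi : i ∈ U
  · have h0 : ∑ u ∈ U, aG G i u * aG G u y = 0 :=
      Finset.sum_eq_zero fun u hu => by simp [aG, hI i hi u hu]
    have h1 : i ≠ y := fun h => hy (h ▸ hi)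
    rw [h0]; simp [dl, hi, h1]; ring
  · have h2 : ∑ u ∈ U, aG G i u * aG G u y = tt G U y i :=
      Finset.sum_congr rfl fun u hu => by rw [aG_symm G i u]; ring
    rw [h2]
    unfold BB
    rw [aG_symm G i y]
    by_cases h : y = i
    · subst h; simp [dl, hi]; ring
    · simp [dl, hi, h, Ne.symm h]; ring

lemma Qf_dl (hI : ∀ u ∈ U, ∀ v ∈ U, ¬ G.Adj u v) (y : V) (hy : y ∉ U) :
    Qf G (dl G U y) (dl G U y) = -4 * (kk G U y - 4) := by
  rw [Qf_eq_QV]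
  simp only [QV_dl hI y hy]
  rw [Finset.sum_eq_single y]
  · simp [dl, hy, BB_self]; ring
  · intro i _ hi
    by_cases h : i ∈ U
    · simp [h]
    · simp [h, dl, hi]
  · simp


lemma kk_int (y : V) (c : ℕ) (h : ¬ kk G U y ≤ c) : (c:ℝ) + 1 ≤ kk G U y := by
  rw [kk_nat] at h ⊢
  have h' : ¬ (U.filter fun u => G.Adj u y).card ≤ c := by exact_mod_cast h
  have : c + 1 ≤ (U.filter fun u => G.Adj u y).card := by omega
  exact_mod_cast this

lemma kk_cases (y : V) (h : kk G U y ≤ 4) :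
    kk G U y = 0 ∨ kk G U y = 1 ∨ kk G U y = 2 ∨ kk G U y = 3 ∨ kk G U y = 4 := by
  rw [kk_nat] at h ⊢
  have h' : (U.filter fun u => G.Adj u y).card ≤ 4 := by exact_mod_cast h
  generalize (U.filter fun u => G.Adj u y).card = m at *
  interval_cases m <;> norm_num

lemma numE (w K B T : ℝ) (hw : 8 ≤ w) (h0 : 0 ≤ K) (hK : K ≤ 4 * w) (hB : 2 * w ≤ B) (hT : K ^ 2 / 29 ≤ T)
    (h : T - 4 * w + 2 * (1.5 * w) * B + (1.5 * w) ^ 2 * (5 - 4) ≤ (K + 2 * w + 1.5 * w * (5 + 2)) ^ 2 / 33) : False := by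
  have h1 : 2 * (1.5 * w) * (2 * w) ≤ 2 * (1.5 * w) * B := by gcongr
  have h2 : 0 ≤ (4 * w - K) * ((K+29*w)/33-(K+4*w)/29) := mul_nonneg (by linarith) (by linarith)
  nlinarith

lemma numWA (w K T : ℝ) (hw : 13 ≤ w) (hT : w ^ 2 + (K - w) ^ 2 / 28 ≤ T)
    (h : T - 4 * w + 2 * (-3 * w / 7) * w + (-3 * w / 7) ^ 2 * (5 - 4) ≤ (K + 2 * w + (-3 * w / 7) * (5 + 2)) ^ 2 / 33) : False := by
  nlinarith [sq_nonneg (K - w)]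

lemma numWB (w K T : ℝ) (hw : 18 ≤ w) (hK0 : w ≤ K) (hK : K ≤ 4 * w) (hT : w ^ 2 + (K - w) ^ 2 / 28 ≤ T)
    (h : T - 4 * w  ≤ (K + 2 * w) ^ 2 / 33) : False := by
  have h2 : 0 ≤ (4 * w - K) * ((K + 2 * w + 6 * w)/33-(K-w+3 * w)/28) := mul_nonneg (by linarith) (by linarith)
  nlinarith

lemma numNB (w K T T0 : ℝ) (hw : 14 ≤ w) (hT0 : 0 ≤ T0) (hK0 : T0 ≤ K) (hK : K ≤ 4 * w) (hT : (K - T0) ^ 2 / 25 ≤ T)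
    (h : T - 4 * w + 2 * (0.8 * w) * (T0 + 2 * w) ≤ (K + 2 * w + (0.8 * w) * (4 + 2)) ^ 2 / 33) : False := by
  have h2 : 0 ≤ (4 * w - K) * ((K + 6.8 * w + 10.8 * w)/33-(K-T0+4 * w)/25) := mul_nonneg (by linarith) (by linarith)
  have h3 : 0 ≤ T0 * (4 * w - T0) := mul_nonneg (by linarith) (by linarith)
  have h4 : 0 ≤ T0 * (4 * w - K) := mul_nonneg (by linarith) (by linarith)
  nlinarith

lemma numX (w K T k s B : ℝ) (N : ℝ) (hw : N + 1 ≤ w) (hT : K ^ 2 / 29 ≤ T) (hB : 2 * w ≤ B)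
    (h : ∀ b : ℝ, T - 4 * w + 2 * (0.3 * w) * B + (0.3 * w) ^ 2 * (k - 4) + 2 * (0.3 * w) * b * s ≤
      (K + 2 * w + (0.3 * w) * (k + 2) + b * (4 + 2)) ^ 2 / 33)
    (hc : (s = 2 ∧ ((k = 0 ∧ N = 11) ∨ (k = 1 ∧ N = 10) ∨ (k = 2 ∧ N = 9) ∨ (k = 3 ∧ N = 8) ∨ (k = 4 ∧ N = 8))) ∨
      (s = 1 ∧ N = 9 ∧ (k = 0 ∨ k = 1 ∨ k = 2 ∨ k = 3 ∨ k = 4))) : False := by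
  have h1 := h ((5.5 * (0.3 * w) * s - K - 2 * w - (0.3 * w) * (k + 2)) / 6)
  have h0 : 0 ≤ w := by
    rcases hc with ⟨_, ⟨_, _⟩ | ⟨_, _⟩ | ⟨_, _⟩ | ⟨_, _⟩ | ⟨_, _⟩⟩ | ⟨_, _, _⟩ <;> linarith
  have h1' : 2 * (0.3 * w) * (2 * w) ≤ 2 * (0.3 * w) * B := by gcongr
  have h2 := sq_nonneg (K - 1.45 * s * w)
  clear h
  rcases hc with ⟨rfl, ⟨rfl, rfl⟩ | ⟨rfl, rfl⟩ | ⟨rfl, rfl⟩ | ⟨rfl, rfl⟩ | ⟨rfl, rfl⟩⟩ | ⟨rfl, rfl, rfl | rfl | rfl | rfl | rfl⟩ <;>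
  nlinarith

lemma Setup.cardE (hS : Setup G U) (y : V) (hy : y ∉ U) (hy5 : kk G U y = 5) :
    (Finset.univ.filter fun z => z ∉ U ∧ z ≠ y ∧ 2 ≤ BB G U y z).card ≤ 7 := by
  set E := Finset.univ.filter fun z => z ∉ U ∧ z ≠ y ∧ 2 ≤ BB G U y z with hE
  have hk4 : ∀ z ∈ E, kk G U z ≤ 4 := by
    intro z hz
    simp only [hE, Finset.mem_filter, Finset.mem_univ, true_and] at hz
    have hp := pair_ineq hS.hM hS.hU hS.hI y z hy hz.1
    have h5 := hS.hk z hz.1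
    by_contra hc
    have := kk_int (G := G) (U := U) z 4 (by exact_mod_cast hc)
    have h5' : kk G U z = 5 := by push_cast at this; linarith
    rw [h5', hy5] at hp
    norm_num at hp; linarith [hz.2.2]
  have hK := KK_le (G := G) (U := U) E 4 hk4
  have hK0 := KK_nonneg G U E
  have hT := T1 (G := G) hS.hU E
  have hs := star3 hS.hM hS.hU hS.hI E (fun w hw => (Finset.mem_filter.mp hw).2.1) y y hy hy 0 (1.5 * E.card)
  have hB : (2:ℝ) * E.card ≤ ∑ w ∈ E, BB G U y w := by
    have := Finset.card_nsmul_le_sum E (fun w => BB G U y w) 2 (fun w hw => (Finset.mem_filter.mp hw).2.2.2)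
    simpa [mul_comm] using this
  rw [hy5] at hs
  by_contra hc
  have hc' : (8:ℝ) ≤ E.card := by
    have : 8 ≤ E.card := by omega
    exact_mod_cast this
  refine numE _ _ _ _ hc' hK0 hK hB hT ?_
  simpa using hs

lemma Setup.cardWA (hS : Setup G U) (y : V) (hy : y ∉ U) (hy5 : kk G U y = 5) (u : V) (hu : u ∈ U) :
    (Finset.univ.filter fun z => z ∉ U ∧ BB G U y z = 1 ∧ G.Adj u z).card ≤ 12 := by
  set E := Finset.univ.filter fun z => z ∉ U ∧ BB G U y z = 1 ∧ G.Adj u z with hE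
  have hT := T2 (G := G) hS.hU E u hu (fun w hw => (Finset.mem_filter.mp hw).2.2.2)
  have hs := star3 hS.hM hS.hU hS.hI E (fun w hw => (Finset.mem_filter.mp hw).2.1) y y hy hy 0 (-3 * E.card / 7)
  have hB : ∑ w ∈ E, BB G U y w = E.card := by
    rw [Finset.sum_congr rfl (g := fun _ => (1:ℝ)) (fun w hw => (Finset.mem_filter.mp hw).2.2.1)]
    simp
  rw [hy5, hB] at hs
  by_contra hc
  have hc' : (13:ℝ) ≤ E.card := by
    have : 13 ≤ E.card := by omega
    exact_mod_cast this
  refine numWA _ _ _ hc' hT.1 ?_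
  simpa using hs

lemma card_le_of_not (s : Finset V) (n : ℕ) (h : ¬ s.card ≤ n) : (n:ℝ) + 1 ≤ s.card := by
  have : n + 1 ≤ s.card := by omega
  exact_mod_cast this

lemma Setup.cardWB (hS : Setup G U) (h4 : ∀ y, y ∉ U → kk G U y ≤ 4) (u : V) (hu : u ∈ U) :
    (Finset.univ.filter fun z => z ∉ U ∧ G.Adj u z).card ≤ 17 := by
  set E := Finset.univ.filter fun z => z ∉ U ∧ G.Adj u z with hE
  have hEU : ∀ w ∈ E, w ∉ U := fun w hw => (Finset.mem_filter.mp hw).2.1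
  have hT := T2 (G := G) hS.hU E u hu (fun w hw => (Finset.mem_filter.mp hw).2.2)
  have hK := KK_le (G := G) (U := U) E 4 (fun w hw => h4 w (hEU w hw))
  by_contra hc
  obtain ⟨y, hy⟩ : E.Nonempty := Finset.card_pos.mp (by omega)
  have hs := star3 hS.hM hS.hU hS.hI E hEU y y (hEU y hy) (hEU y hy) 0 0
  refine numWB _ _ _ ?_ hT.2 hK hT.1 ?_
  · have := card_le_of_not _ _ hc; norm_num at this; exact_mod_cast this
  · simpa using hs

lemma Setup.cardNB (hS : Setup G U) (h4 : ∀ y, y ∉ U → kk G U y ≤ 4) (y : V) (hy : y ∉ U) (hy4 : kk G U y = 4) :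
    (Finset.univ.filter fun z => z ∉ U ∧ G.Adj y z).card ≤ 13 := by
  set E := Finset.univ.filter fun z => z ∉ U ∧ G.Adj y z with hE
  have hEU : ∀ w ∈ E, w ∉ U := fun w hw => (Finset.mem_filter.mp hw).2.1
  have hT := T3 (G := G) hS.hU E y hy4
  have hK := KK_le (G := G) (U := U) E 4 (fun w hw => h4 w (hEU w hw))
  by_contra hc
  have hs := star3 hS.hM hS.hU hS.hI E hEU y y hy hy 0 (0.8 * E.card)
  have hB : ∑ w ∈ E, BB G U y w = ∑ w ∈ E, tt G U y w + 2 * E.card := by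
    have e : (2:ℝ) * E.card = ∑ w ∈ E, (2:ℝ) := by simp [mul_comm]
    rw [e, ← Finset.sum_add_distrib]
    refine Finset.sum_congr rfl fun w hw => ?_
    have ha : G.Adj y w := (Finset.mem_filter.mp hw).2.2
    simp [BB, aG, ha, ha.ne]
  rw [hB, hy4] at hs
  refine numNB _ _ _ _ ?_ (Finset.sum_nonneg fun _ _ => tt_nonneg _ _ _ _) hT.2 hK hT.1 ?_
  · have := card_le_of_not _ _ hc; norm_num at this; exact_mod_cast this
  · simpa using hs

lemma Setup.cardX (hS : Setup G U) (h4 : ∀ y, y ∉ U → kk G U y ≤ 4) (y z : V) (hy : y ∉ U) (hy4 : kk G U y = 4)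
    (hz : z ∉ U) (hyz : BB G U y z = 1 ∨ BB G U y z = 2) :
    (Finset.univ.filter fun x => x ∈ U ∧ G.Adj z x).card +
    (Finset.univ.filter fun x => x ∉ U ∧ G.Adj z x ∧ BB G U y x = 0).card ≤ 13 := by
  set E := Finset.univ.filter fun x => x ∉ U ∧ G.Adj z x ∧ BB G U y x = 0 with hE
  have hEU : ∀ w ∈ E, w ∉ U := fun w hw => (Finset.mem_filter.mp hw).2.1
  have hT := T1 (G := G) hS.hU E
  have hkz : kk G U z = ((Finset.univ.filter fun x => x ∈ U ∧ G.Adj z x).card : ℝ) := by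
    rw [kk_nat]; congr 2; ext x; simp [G.adj_comm]
  set m := (Finset.univ.filter fun x => x ∈ U ∧ G.Adj z x).card
  have hs : ∀ b : ℝ, _ := fun b => star3 hS.hM hS.hU hS.hI E hEU z y hz hy (0.3 * E.card) b
  have hB : (2:ℝ) * E.card ≤ ∑ w ∈ E, BB G U z w := by
    have := Finset.card_nsmul_le_sum E (fun w => BB G U z w) 2
      (fun w hw => BB_pos_of_adj G U (Finset.mem_filter.mp hw).2.2.1)
    simpa [mul_comm] using this
  have hB0 : ∑ w ∈ E, BB G U y w = 0 :=
    Finset.sum_eq_zero (fun w hw => (Finset.mem_filter.mp hw).2.2.2)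
  rw [hB0, hy4] at hs
  by_contra hc
  have hm4 : m ≤ 4 := by
    have := h4 z hz
    rw [hkz] at this; exact_mod_cast this
  have hw : (13:ℝ) - m + 1 ≤ E.card := by
    have : 14 ≤ m + E.card := by omega
    have : (14:ℝ) ≤ m + E.card := by exact_mod_cast this
    linarith
  have hs' : ∀ b : ℝ, TT G U E - 4 * E.card + 2 * (0.3 * E.card) * ∑ w ∈ E, BB G U z w
      + (0.3 * E.card) ^ 2 * (kk G U z - 4) + 2 * (0.3 * E.card) * b * BB G U y z ≤
      (KK G U E + 2 * E.card + (0.3 * E.card) * (kk G U z + 2) + b * (4 + 2)) ^ 2 / 33 := by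
    intro b
    simpa using hs b
  rcases hyz with h1 | h1
  · refine numX _ _ _ _ _ _ 9 ?_ hT hB hs' (Or.inr ⟨h1, rfl, kk_cases z (h4 z hz)⟩)
    have : (m:ℝ) ≤ 4 := by exact_mod_cast hm4
    linarith
  · rw [hkz] at hs'
    have := numX _ _ _ _ _ _ (if m = 0 then 11 else if m = 1 then 10 else if m = 2 then 9 else 8) ?_ hT hB hs' (Or.inl ⟨h1, ?_⟩)
    · exact this
    · generalize (E.card : ℝ) = w at *
      clear * - hw hm4
      interval_cases m <;> norm_num at * <;> linarith
    · clear * - hm4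
      interval_cases m <;> norm_num

end helpers

section helpers
open scoped Classical

variable {V : Type} [Fintype V] {G : SimpleGraph V} {U : Finset V}

theorem Setup.caseA (hS : Setup G U) (y : V) (hy : y ∉ U) (hy5 : kk G U y = 5) : Good G := by
  refine ⟨dl G U y, dl_nonneg y, by rw [Qf_dl hS.hI y hy, hy5]; norm_num, ?_⟩
  set N := U.filter fun u => G.Adj u y with hN
  have hNc : N.card = 5 := by
    have := kk_nat G U y
    rw [hy5] at this
    exact_mod_cast this.symm
  have hsub : (Finset.univ.filter fun i => QV G (dl G U y) i ≠ 0) ⊆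
      {y} ∪ ((Finset.univ.filter fun z => z ∉ U ∧ z ≠ y ∧ 2 ≤ BB G U y z) ∪
        N.biUnion fun u => Finset.univ.filter fun z => z ∉ U ∧ BB G U y z = 1 ∧ G.Adj u z) := by
    intro i hi
    simp only [Finset.mem_filter, Finset.mem_univ, true_and] at hi
    rw [QV_dl hS.hI y hy] at hi
    by_cases hiU : i ∈ U
    · simp [hiU] at hi
    simp only [hiU, if_false] at hi
    have hB : BB G U y i ≠ 0 := by
      intro h; apply hi; rw [h]; simp
    by_cases hiy : i = y
    · simp [hiy]
    simp only [Finset.mem_union, Finset.mem_biUnion, Finset.mem_singleton, hiy, false_or]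
    obtain ⟨m, hm⟩ := BB_nat G U (Ne.symm hiy)
    by_cases hm2 : 2 ≤ m
    · left
      simp only [Finset.mem_filter, Finset.mem_univ, true_and]
      refine ⟨hiU, hiy, ?_⟩
      rw [hm]; exact_mod_cast hm2
    · right
      have hm1 : m = 1 := by
        have : m ≠ 0 := by rintro rfl; apply hB; simp [hm]
        omega
      have hB1 : BB G U y i = 1 := by rw [hm, hm1]; simp
      rcases BB_pos_cases G U (Ne.symm hiy) hB with h | ⟨u, hu, h1, h2⟩
      · have := BB_pos_of_adj G U h
        linarith
      · exact ⟨u, by simp [hN, hu, h1], by simp [hiU, hB1, h2]⟩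
  refine (Finset.card_le_card hsub).trans ?_
  refine (Finset.card_union_le _ _).trans ?_
  have h1 := Finset.card_union_le (Finset.univ.filter fun z => z ∉ U ∧ z ≠ y ∧ 2 ≤ BB G U y z)
        (N.biUnion fun u => Finset.univ.filter fun z => z ∉ U ∧ BB G U y z = 1 ∧ G.Adj u z)
  have h2 := hS.cardE y hy hy5
  have h3 := Finset.card_biUnion_le_card_mul N (fun u => Finset.univ.filter fun z => z ∉ U ∧ BB G U y z = 1 ∧ G.Adj u z) 12
    (fun u hu => hS.cardWA y hy hy5 u (Finset.mem_filter.mp hu).1)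
  rw [hNc] at h3
  simp only [Finset.card_singleton]
  omega

theorem Setup.caseB (hS : Setup G U) (h4 : ∀ y, y ∉ U → kk G U y ≤ 4) (y : V) (hy : y ∉ U) (hy4 : kk G U y = 4)
    (z : V) (hz : z ∉ U) (hyz : y ≠ z) (hB : BB G U y z ≠ 0) : Good G := by
  have hs : BB G U y z = 1 ∨ BB G U y z = 2 := by
    obtain ⟨m, hm⟩ := BB_nat G U hyz
    have hp := pair_ineq hS.hM hS.hU hS.hI y z hy hz
    have hm0 : m ≠ 0 := by rintro rfl; apply hB; simp [hm]
    have hm2 : m ≤ 2 := by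
      by_contra hc
      have : 3 ≤ m := by omega
      have h3 : (3:ℝ) ≤ BB G U y z := by rw [hm]; exact_mod_cast this
      rw [hy4] at hp
      rcases kk_cases z (h4 z hz) with h | h | h | h | h <;> rw [h] at hp <;> norm_num at hp <;> linarith
    rw [hm]
    interval_cases m <;> simp_all
  have hs1 : 1 ≤ BB G U y z := by rcases hs with h | h <;> rw [h] <;> norm_num
  set h : V → ℝ := (2:ℝ) • dl G U y + Pi.single z 1 with hh
  have hQV : ∀ i, QV G h i = 2 * (if i ∈ U then 0 else -2 * BB G U y i) + ((if i = z then 4 else 0) - 2 * aG G i z) := by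
    intro i
    rw [hh, QV_add, QV_smul, QV_dl hS.hI y hy, QV_single]
  refine ⟨h, ?_, ?_, ?_⟩
  · intro i
    have := dl_nonneg (G := G) (U := U) y i
    simp only [hh, Pi.add_apply, Pi.smul_apply, smul_eq_mul, Pi.single_apply]
    split_ifs <;> linarith
  · have hQe : ∀ x, Qf G (Pi.single z 1) x = QV G x z := by
      intro x
      rw [Qf_eq_QV]
      simp [Pi.single_apply]
    rw [hh, Qf_add_left, Qf_add_right, Qf_symm G ((2:ℝ) • dl G U y) (Pi.single z 1), Qf_smul_left, Qf_smul_right,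
      Qf_dl hS.hI y hy, hQe, hQe, QV_add, QV_smul, QV_dl hS.hI y hy, QV_single, aG_self, hy4]
    simp [hz]
    linarith
  · set N := U.filter fun u => G.Adj u y with hN
    have hNc : N.card = 4 := by
      have := kk_nat G U y
      rw [hy4] at this
      exact_mod_cast this.symm
    set A := N.biUnion fun u => (Finset.univ.filter fun z => z ∉ U ∧ G.Adj u z).erase y with hA
    set C := Finset.univ.filter fun z => z ∉ U ∧ G.Adj y z with hC
    set F := Finset.univ.filter fun x => x ∈ U ∧ G.Adj z x with hF
    set X := Finset.univ.filter fun x => x ∉ U ∧ G.Adj z x ∧ BB G U y x = 0 with hX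
    have hsub : (Finset.univ.filter fun i => QV G h i ≠ 0) ⊆ {y} ∪ ((A ∪ C) ∪ (F ∪ X)) := by
      intro i hi
      simp only [Finset.mem_filter, Finset.mem_univ, true_and] at hi
      rw [hQV] at hi
      by_cases hiy : i = y
      · simp [hiy]
      by_cases hiU : i ∈ U
      · have : i ≠ z := fun h => hz (h ▸ hiU)
        have hadj : G.Adj z i := by
          by_contra hc
          apply hi
          have : ¬ G.Adj i z := fun h => hc h.symm
          simp_all [aG]
        simp only [Finset.mem_union]; right; right; left
        simp [hF, hiU, hadj]
      by_cases hBi : BB G U y i = 0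
      · have hiz : i ≠ z := by rintro rfl; exact hB hBi
        have hadj : G.Adj z i := by
          by_contra hc
          apply hi
          have : ¬ G.Adj i z := fun h => hc h.symm
          simp [aG, this, hBi, hiz]
        simp only [Finset.mem_union]; right; right; right
        simp [hX, hiU, hadj, hBi]
      · simp only [Finset.mem_union]; right; left
        rcases BB_pos_cases G U (Ne.symm hiy) hBi with h | ⟨u, hu, h1, h2⟩
        · right; simp [hC, hiU, h]
        · left
          simp only [hA, Finset.mem_biUnion]
          exact ⟨u, by simp [hN, hu, h1], by simp [hiU, hiy, h2]⟩
    refine (Finset.card_le_card hsub).trans ?_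
    have h1 := Finset.card_union_le {y} ((A ∪ C) ∪ (F ∪ X))
    have h2 := Finset.card_union_le (A ∪ C) (F ∪ X)
    have h3 := Finset.card_union_le A C
    have h5 := Finset.card_union_le F X
    have h6 : F.card + X.card ≤ 13 := hS.cardX h4 y z hy hy4 hz hs
    have h7 : C.card ≤ 13 := hS.cardNB h4 y hy hy4
    have h8 : A.card ≤ N.card * 16 := by
      refine Finset.card_biUnion_le_card_mul _ _ _ fun u hu => ?_
      have hu' := Finset.mem_filter.mp hu
      have := hS.cardWB h4 u hu'.1
      rw [Finset.card_erase_of_mem]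
      · omega
      · simp [hy, hu'.2]
    rw [hNc] at h8
    simp only [Finset.card_singleton] at h1
    omega

end helpers

section helpers
open scoped Classical

variable {V : Type} [Fintype V] {G : SimpleGraph V} {U : Finset V}

lemma numCU (w K T : ℝ) (hw : 11 ≤ w) (hK : K ≤ 3 * w) (hK0 : w ≤ K) (hT : w ^ 2 + (K - w) ^ 2 / 28 ≤ T)
    (h : T - 4 * w  ≤ (K + 2 * w) ^ 2 / 33) : False := by
  have h2 : 0 ≤ (3 * w - K) * ((K + 2 * w + 5 * w)/33-(K-w+2 * w)/28) := mul_nonneg (by linarith) (by linarith)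
  nlinarith

lemma numCY (w K T k α B : ℝ) (N : ℝ) (hw : N + 1 ≤ w) (h0 : 0 ≤ K) (hK : K ≤ 3 * w) (hT : K ^ 2 / 29 ≤ T) (hB : 2 * w ≤ B)
    (h : T - 4 * w + 2 * (α * w) * B + (α * w) ^ 2 * (k - 4) ≤
      (K + 2 * w + (α * w) * (k + 2)) ^ 2 / 33)
    (hc : (k = 0 ∧ α = 0.41 ∧ N = 15) ∨ (k = 1 ∧ α = 0.47 ∧ N = 14) ∨ (k = 2 ∧ α = 0.56 ∧ N = 11) ∨ (k = 3 ∧ α = 0.68 ∧ N = 9)) :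
    False := by
  have h0 : 0 ≤ w := by
    rcases hc with ⟨_, _, _⟩ | ⟨_, _, _⟩ | ⟨_, _, _⟩ | ⟨_, _, _⟩ <;> linarith
  have h00 : 0 ≤ α * w := by
    rcases hc with ⟨_, h, _⟩ | ⟨_, h, _⟩ | ⟨_, h, _⟩ | ⟨_, h, _⟩ <;> rw [h] <;> positivity
  have h1' : 2 * (α * w) * (2 * w) ≤ 2 * (α * w) * B := by gcongr
  have h2 : 0 ≤ (3 * w - K) * ((K + 3 * w + 4 * w + 2 * (α * w * (k + 2)))/33-(K + 3 * w)/29) := by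
    refine mul_nonneg (by linarith) ?_
    rcases hc with ⟨rfl, rfl, _⟩ | ⟨rfl, rfl, _⟩ | ⟨rfl, rfl, _⟩ | ⟨rfl, rfl, _⟩ <;> linarith
  rcases hc with ⟨rfl, rfl, rfl⟩ | ⟨rfl, rfl, rfl⟩ | ⟨rfl, rfl, rfl⟩ | ⟨rfl, rfl, rfl⟩ <;> nlinarith

lemma Setup.degU (hS : Setup G U) (hC : ∀ y z, y ∉ U → z ∉ U → y ≠ z → BB G U y z ≠ 0 → kk G U y ≤ 3)
    (u : V) (hu : u ∈ U) : (Finset.univ.filter fun z => G.Adj u z).card ≤ 15 := by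
  set E := Finset.univ.filter fun z => G.Adj u z with hE
  by_contra hc
  have hEU : ∀ w ∈ E, w ∉ U := fun w hw h => hS.hI u hu w h (Finset.mem_filter.mp hw).2
  have hT := T2 (G := G) hS.hU E u hu (fun w hw => (Finset.mem_filter.mp hw).2)
  have hK := KK_le (G := G) (U := U) E 3 (fun w hw => by
    obtain ⟨w', hw', hne⟩ := Finset.exists_mem_ne (s := E) (by omega) w
    have := BB_pos_of_common G U hu hne.symm (Finset.mem_filter.mp hw).2 (Finset.mem_filter.mp hw').2
    exact hC w w' (hEU w hw) (hEU w' hw') hne.symm (by linarith))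
  obtain ⟨y, hy⟩ : E.Nonempty := Finset.card_pos.mp (by omega)
  have hs := star3 hS.hM hS.hU hS.hI E hEU y y (hEU y hy) (hEU y hy) 0 0
  refine numCU _ _ _ ?_ hK hT.2 hT.1 ?_
  · have := card_le_of_not _ _ hc; push_cast at this; linarith
  · simpa using hs

lemma Setup.degY (hS : Setup G U) (h4 : ∀ y, y ∉ U → kk G U y ≤ 4) 
    (hC : ∀ y z, y ∉ U → z ∉ U → y ≠ z → BB G U y z ≠ 0 → kk G U y ≤ 3)
    (z : V) (hz : z ∉ U) : (Finset.univ.filter fun x => G.Adj z x).card ≤ 15 := by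
  have hsplit : (Finset.univ.filter fun x => G.Adj z x).card =
    (Finset.univ.filter fun x => x ∈ U ∧ G.Adj z x).card + (Finset.univ.filter fun x => x ∉ U ∧ G.Adj z x).card := by
    rw [← Finset.card_filter_add_card_filter_not (s := Finset.univ.filter fun x => G.Adj z x) (fun x => x ∈ U)]
    rw [Finset.filter_filter, Finset.filter_filter]
    simp only [and_comm]
  have hkz : kk G U z = ((Finset.univ.filter fun x => x ∈ U ∧ G.Adj z x).card : ℝ) := by
    rw [kk_nat]; congr 2; ext x; simp [G.adj_comm]
  rw [hsplit]
  set E := Finset.univ.filter fun x => x ∉ U ∧ G.Adj z x with hE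
  set m := (Finset.univ.filter fun x => x ∈ U ∧ G.Adj z x).card
  by_contra hc
  have hm4 : m ≤ 4 := by
    have := h4 z hz
    rw [hkz] at this; exact_mod_cast this
  have hEU : ∀ w ∈ E, w ∉ U := fun w hw => (Finset.mem_filter.mp hw).2.1
  have hT := T1 (G := G) hS.hU E
  have hB : (2:ℝ) * E.card ≤ ∑ w ∈ E, BB G U z w := by
    have := Finset.card_nsmul_le_sum E (fun w => BB G U z w) 2
      (fun w hw => BB_pos_of_adj G U (Finset.mem_filter.mp hw).2.2)
    simpa [mul_comm] using this
  have hK := KK_le (G := G) (U := U) E 3 (fun w hw => by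
    have hw' := (Finset.mem_filter.mp hw).2
    have := BB_pos_of_adj G U hw'.2.symm
    exact hC w z hw'.1 hz hw'.2.ne.symm (by linarith))
  obtain ⟨y, hy⟩ : E.Nonempty := Finset.card_pos.mp (by omega)
  have hm3 : m ≤ 3 := by
    have hw' := (Finset.mem_filter.mp hy).2
    have := BB_pos_of_adj G U hw'.2
    have := hC z y hz hw'.1 hw'.2.ne (by linarith)
    rw [hkz] at this; exact_mod_cast this
  have hs : ∀ α : ℝ, TT G U E - 4 * E.card + 2 * (α * E.card) * ∑ w ∈ E, BB G U z w
      + (α * E.card) ^ 2 * (m - 4) ≤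
      (KK G U E + 2 * E.card + (α * E.card) * (m + 2)) ^ 2 / 33 := by
    intro α
    have hs := star3 hS.hM hS.hU hS.hI E hEU z z hz hz (α * E.card) 0
    rw [hkz] at hs
    simpa using hs
  have hw : (15:ℝ) - m + 1 ≤ E.card := by
    have : 16 ≤ m + E.card := by omega
    have : (16:ℝ) ≤ m + E.card := by exact_mod_cast this
    linarith
  refine numCY _ _ _ _ (if m = 0 then 0.41 else if m = 1 then 0.47 else if m = 2 then 0.56 else 0.68) _
    (if m = 0 then 15 else if m = 1 then 14 else if m = 2 then 11 else 9) ?_ (KK_nonneg G U E) hK hT hB (hs _) ?_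
  · generalize (E.card : ℝ) = w at *
    clear * - hw hm3
    interval_cases m <;> norm_num at * <;> linarith
  · clear * - hm3
    interval_cases m <;> norm_num

/-- max degree is at most 15 in case C -/
lemma Setup.deg (hS : Setup G U) (h4 : ∀ y, y ∉ U → kk G U y ≤ 4) 
    (hC : ∀ y z, y ∉ U → z ∉ U → y ≠ z → BB G U y z ≠ 0 → kk G U y ≤ 3)
    (z : V) : (Finset.univ.filter fun x => G.Adj z x).card ≤ 15 := by
  by_cases h : z ∈ U
  · exact hS.degU hC z h
  · exact hS.degY h4 hC z h

end helpers

section helpers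
open scoped Classical

variable {V : Type} [Fintype V] {G : SimpleGraph V}

/-- combination of basis vectors -/
noncomputable def comb {r : ℕ} (v : Fin r → V) (c : Fin r → ℕ) : V → ℝ :=
  fun x => ∑ i, if v i = x then (c i : ℝ) else 0

lemma comb_nonneg {r : ℕ} (v : Fin r → V) (c : Fin r → ℕ) (x : V) : 0 ≤ comb v c x := by
  unfold comb
  exact Finset.sum_nonneg fun i _ => by split_ifs <;> positivity

lemma comb_ne {r : ℕ} (v : Fin r → V) (c : Fin r → ℕ) (x : V) (h : comb v c x ≠ 0) : ∃ i, v i = x := by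
  by_contra hc
  push Not at hc
  apply h
  unfold comb
  exact Finset.sum_eq_zero fun i _ => by simp [hc i]

lemma comb_sum {r : ℕ} (v : Fin r → V) (c : Fin r → ℕ) (g : V → ℝ) :
    ∑ x, g x * comb v c x = ∑ i, g (v i) * c i := by
  unfold comb
  simp only [Finset.mul_sum]
  rw [Finset.sum_comm]
  refine Finset.sum_congr rfl fun i _ => ?_
  simp

lemma comb_apply {r : ℕ} (v : Fin r → V) (hv : Function.Injective v) (c : Fin r → ℕ) (i : Fin r) :
    comb v c (v i) = c i := by
  unfold comb
  simp [hv.eq_iff]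

lemma Qf_comb {r : ℕ} (v : Fin r → V) (hv : Function.Injective v) (c : Fin r → ℕ)
    (E : Finset (Fin r × Fin r)) (hlt : ∀ p ∈ E, p.1 < p.2) (hE : ∀ p ∈ E, G.Adj (v p.1) (v p.2)) :
    Qf G (comb v c) (comb v c) ≤ 4 * ((∑ i, c i * c i : ℕ) : ℝ) - 4 * ((∑ p ∈ E, c p.1 * c p.2 : ℕ) : ℝ) := by
  have h1 : Qf G (comb v c) (comb v c) = 4 * ∑ i, (c i * c i : ℝ) - 2 * ∑ p : Fin r × Fin r, aG G (v p.1) (v p.2) * c p.1 * c p.2 := by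
    rw [Qf_symm, Qf_eq_QV]
    have e : ∑ i, comb v c i * QV G (comb v c) i = ∑ i, QV G (comb v c) i * comb v c i :=
      Finset.sum_congr rfl fun _ _ => mul_comm _ _
    rw [e, comb_sum]
    unfold QV
    simp only [comb_sum, comb_apply v hv]
    rw [Fintype.sum_prod_type, Finset.mul_sum, Finset.mul_sum, ← Finset.sum_sub_distrib]
    refine Finset.sum_congr rfl fun i _ => ?_
    rw [sub_mul, mul_assoc, mul_assoc, Finset.sum_mul]
    congr 2
    refine Finset.sum_congr rfl fun j _ => ?_
    ring
  rw [h1]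
  set F : Fin r × Fin r → ℝ := fun p => aG G (v p.1) (v p.2) * c p.1 * c p.2 with hF
  have hF0 : ∀ p, 0 ≤ F p := fun p => by
    have := aG_nonneg G (v p.1) (v p.2)
    simp only [hF]; positivity
  have h2 : ∑ p ∈ E ∪ E.map ⟨Prod.swap, Prod.swap_injective⟩, F p ≤ ∑ p, F p :=
    Finset.sum_le_sum_of_subset_of_nonneg (Finset.subset_univ _) fun p _ _ => hF0 p
  rw [Finset.sum_union, Finset.sum_map] at h2
  · have h3 : ∑ p ∈ E, F p = ∑ p ∈ E, (c p.1 * c p.2 : ℝ) :=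
      Finset.sum_congr rfl fun p hp => by simp [hF, aG, hE p hp]
    have h4 : ∑ p ∈ E, F ((⟨Prod.swap, Prod.swap_injective⟩ : Fin r × Fin r ↪ Fin r × Fin r) p) = ∑ p ∈ E, (c p.1 * c p.2 : ℝ) :=
      Finset.sum_congr rfl fun p hp => by simp [hF, aG, (hE p hp).symm, mul_comm]
    rw [h3, h4] at h2
    push_cast
    linarith
  · rw [Finset.disjoint_left]
    intro p hp hp'
    simp only [Finset.mem_map, Function.Embedding.coeFn_mk] at hp'
    obtain ⟨q, hq, rfl⟩ := hp'
    have a1 := hlt _ hp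
    have a2 := hlt _ hq
    simp at a1
    exact absurd a1 (not_lt.mpr a2.le)

lemma QV_ne (h : V → ℝ) (i : V) (hi : QV G h i ≠ 0) : h i ≠ 0 ∨ ∃ j, G.Adj j i ∧ h j ≠ 0 := by
  by_contra hc
  push Not at hc
  apply hi
  unfold QV
  rw [hc.1, Finset.sum_eq_zero]
  · simp
  · intro j _
    by_cases hj : G.Adj j i
    · simp [hc.2 j hj]
    · have : ¬ G.Adj i j := fun h => hj h.symm
      simp [aG, this]

lemma card_QV_le (h : V → ℝ) (S : Finset V) (hS : ∀ i, h i ≠ 0 → i ∈ S) (d : ℕ)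
    (hd : ∀ x, (Finset.univ.filter fun y => G.Adj x y).card ≤ d) :
    (Finset.univ.filter fun i => QV G h i ≠ 0).card ≤ S.card * (d + 1) := by
  have hsub : (Finset.univ.filter fun i => QV G h i ≠ 0) ⊆
      S.biUnion fun s => insert s (Finset.univ.filter fun y => G.Adj s y) := by
    intro i hi
    simp only [Finset.mem_filter, Finset.mem_univ, true_and] at hi
    simp only [Finset.mem_biUnion]
    rcases QV_ne h i hi with h1 | ⟨j, h1, h2⟩
    · exact ⟨i, hS i h1, by simp⟩
    · exact ⟨j, hS j h2, by simp [h1]⟩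
  refine (Finset.card_le_card hsub).trans (Finset.card_biUnion_le_card_mul _ _ _ fun s _ => ?_)
  exact (Finset.card_insert_le _ _).trans (Nat.succ_le_succ (hd s))

/-- enumeration of a star -/
lemma star_enum (x : V) (k : ℕ) (h : k ≤ (Finset.univ.filter fun y => G.Adj x y).card) :
    ∃ v : Fin (k + 1) → V, Function.Injective v ∧ v 0 = x ∧ ∀ i : Fin k, G.Adj x (v i.succ) := by
  obtain ⟨N, hN, hc⟩ := Finset.exists_subset_card_eq h
  have e := N.equivFinOfCardEq hc
  refine ⟨Fin.cons x fun i => (e.symm i : V), ?_, rfl, ?_⟩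
  · rw [Fin.cons_injective_iff]
    refine ⟨?_, ?_⟩
    · rintro ⟨i, hi⟩
      have h1 := hN (e.symm i).2
      change ((e.symm i : N) : V) = x at hi
      rw [hi] at h1
      simp at h1
    · intro i j hij
      exact e.symm.injective (Subtype.ext hij)
  · intro i
    have h1 := hN (e.symm i).2
    simpa using h1

theorem caseC3 (hd : ∀ x, (Finset.univ.filter fun y => G.Adj x y).card ≤ 15) (x : V)
    (hx : 5 ≤ (Finset.univ.filter fun y => G.Adj x y).card) : Good G := by
  obtain ⟨v, hv, hv0, hadj⟩ := star_enum x 5 hx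
  refine ⟨comb v ![2,1,1,1,1,1], comb_nonneg _ _, ?_, ?_⟩
  · have := Qf_comb (G := G) v hv ![2,1,1,1,1,1] {(0,1),(0,2),(0,3),(0,4),(0,5)} (by decide) (by
      intro p hp
      simp only [Finset.mem_insert, Finset.mem_singleton] at hp
      rcases hp with rfl | rfl | rfl | rfl | rfl <;> simp only [hv0]
      exacts [hadj 0, hadj 1, hadj 2, hadj 3, hadj 4])
    have e1 : (∑ i, (![2,1,1,1,1,1] : Fin 6 → ℕ) i * (![2,1,1,1,1,1] : Fin 6 → ℕ) i) = 9 := by decide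
    have e2 : (∑ p ∈ ({(0,1),(0,2),(0,3),(0,4),(0,5)} : Finset (Fin 6 × Fin 6)),
      (![2,1,1,1,1,1] : Fin 6 → ℕ) p.1 * (![2,1,1,1,1,1] : Fin 6 → ℕ) p.2) = 10 := by decide
    rw [e1, e2] at this
    norm_num at this
    linarith
  · have hsub : (Finset.univ.filter fun i => QV G (comb v ![2,1,1,1,1,1]) i ≠ 0) ⊆
      ({x} ∪ (Finset.univ.filter fun y => G.Adj x y)) ∪
        Finset.univ.biUnion fun i : Fin 5 => (Finset.univ.filter fun y => G.Adj (v i.succ) y).erase x := by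
      intro i hi
      simp only [Finset.mem_filter, Finset.mem_univ, true_and] at hi
      simp only [Finset.mem_union, Finset.mem_biUnion, Finset.mem_singleton]
      by_cases hix : i = x
      · exact Or.inl (Or.inl hix)
      rcases QV_ne _ i hi with h1 | ⟨j, h1, h2⟩
      · obtain ⟨k, rfl⟩ := comb_ne _ _ _ h1
        left; right
        rcases Fin.eq_zero_or_eq_succ k with rfl | ⟨l, rfl⟩
        · exact absurd hv0 hix
        · simpa using hadj l
      · obtain ⟨k, rfl⟩ := comb_ne _ _ _ h2
        rcases Fin.eq_zero_or_eq_succ k with rfl | ⟨l, rfl⟩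
        · left; right
          rw [hv0] at h1; simpa using h1
        · right
          exact ⟨l, by simp, by simp [hix, h1]⟩
    refine (Finset.card_le_card hsub).trans ?_
    refine (Finset.card_union_le _ _).trans ?_
    have h1 := Finset.card_union_le {x} (Finset.univ.filter fun y => G.Adj x y)
    have h2 := hd x
    have h3 := Finset.card_biUnion_le_card_mul (Finset.univ : Finset (Fin 5))
      (fun i : Fin 5 => (Finset.univ.filter fun y => G.Adj (v i.succ) y).erase x) 14 (fun i _ => by
        rw [Finset.card_erase_of_mem]
        · have := hd (v i.succ); omega
        · simpa using (hadj i).symm)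
    simp only [Finset.card_singleton] at h1
    simp only [Finset.card_univ, Fintype.card_fin] at h3
    omega

/-- A component together with a nonnegative vector with negative form. -/
structure Comp (G : SimpleGraph V) (C : Finset V) (h : V → ℝ) : Prop where
  closed : ∀ x ∈ C, ∀ y, G.Adj x y → y ∈ C
  conn : ∀ x ∈ C, ∀ y ∈ C, G.Reachable x y
  nonneg : ∀ i, 0 ≤ h i
  supp : ∀ i, h i ≠ 0 → i ∈ C
  neg : Qf G h h < 0

lemma Comp.good {C : Finset V} {h : V → ℝ} (hC : Comp G C h) (hcard : C.card ≤ 91) : Good G := by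
  refine ⟨h, hC.nonneg, hC.neg, (Finset.card_le_card ?_).trans hcard⟩
  intro i hi
  simp only [Finset.mem_filter, Finset.mem_univ, true_and] at hi
  rcases QV_ne h i hi with h1 | ⟨j, h1, h2⟩
  · exact hC.supp i h1
  · exact hC.closed j (hC.supp j h2) i h1

lemma reach_closed (P : V → Prop) (hP : ∀ x, P x → ∀ y, G.Adj x y → P y) (x y : V) (hx : P x)
    (h : G.Reachable x y) : P y := by
  obtain ⟨w⟩ := h
  induction w with
  | nil => exact hx
  | cons hadj _ ih => exact ih (hP _ hx _ hadj)

theorem Comp.ext {C : Finset V} {h : V → ℝ} (hC : Comp G C h)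
    (hd : ∀ x, (Finset.univ.filter fun y => G.Adj x y).card ≤ 4)
    {r : ℕ} (hr : r ≤ 9) (v : Fin r → V) (hv : Function.Injective v) (c : Fin r → ℕ) (hc : ∀ i, 1 ≤ c i)
    (E : Finset (Fin r × Fin r)) (hlt : ∀ p ∈ E, p.1 < p.2)
    (hE : ∀ p ∈ E, G.Adj (v p.1) (v p.2)) (hsum : ∑ i, c i * c i ≤ ∑ p ∈ E, c p.1 * c p.2)
    (i0 : Fin r) (hi0 : v i0 ∈ C) : Good G := by
  by_cases hcl : ∀ i y, G.Adj (v i) y → ∃ j, v j = y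
  · have hsub : C ⊆ Finset.univ.image v := by
      intro y hy
      have := reach_closed (G := G) (fun x => ∃ j, v j = x) (by
        rintro x ⟨j, rfl⟩ y hy; exact hcl j y hy) (v i0) y ⟨i0, rfl⟩ (hC.conn _ hi0 _ hy)
      simpa using this
    refine hC.good ((Finset.card_le_card hsub).trans (Finset.card_image_le.trans ?_))
    simp; omega
  · push Not at hcl
    obtain ⟨i, z, hadj, hz⟩ := hcl
    have hQ : Qf G (comb v c) (comb v c) ≤ 0 := by
      have := Qf_comb (G := G) v hv c E hlt hE
      have h2 : ((∑ i, c i * c i : ℕ) : ℝ) ≤ ((∑ p ∈ E, c p.1 * c p.2 : ℕ) : ℝ) := by exact_mod_cast hsum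
      linarith
    have hz0 : comb v c z = 0 := by
      by_contra hne
      obtain ⟨j, hj⟩ := comb_ne _ _ _ hne
      exact hz j hj
    have hQz : QV G (comb v c) z ≤ -2 := by
      unfold QV
      rw [hz0, comb_sum]
      have h1 : aG G z (v i) * c i ≤ ∑ j, aG G z (v j) * c j :=
        Finset.single_le_sum (f := fun j => aG G z (v j) * (c j : ℝ)) (fun j _ => mul_nonneg (aG_nonneg _ _ _) (by positivity)) (Finset.mem_univ i)
      have h2 : aG G z (v i) = 1 := by simp [aG, hadj.symm]
      have h3 : (1:ℝ) ≤ c i := by exact_mod_cast hc i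
      rw [h2] at h1
      linarith
    refine ⟨(2:ℝ) • comb v c + Pi.single z 1, ?_, ?_, ?_⟩
    · intro x
      have := comb_nonneg v c x
      simp only [Pi.add_apply, Pi.smul_apply, smul_eq_mul, Pi.single_apply]
      split_ifs <;> linarith
    · have hQe : ∀ x, Qf G (Pi.single z 1) x = QV G x z := by
        intro x
        rw [Qf_eq_QV]
        simp [Pi.single_apply]
      rw [Qf_add_left, Qf_add_right, Qf_symm G ((2:ℝ) • comb v c) (Pi.single z 1), Qf_smul_left, Qf_smul_right,
        hQe, hQe, QV_add, QV_smul, QV_single, aG_self]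
      simp
      linarith
    · refine (card_QV_le _ (insert z (Finset.univ.image v)) ?_ 4 hd).trans ?_
      · intro x hx
        by_contra hn
        simp only [Finset.mem_insert, Finset.mem_image, Finset.mem_univ, true_and, not_or] at hn
        apply hx
        have : comb v c x = 0 := by
          by_contra hne
          exact hn.2 (comb_ne _ _ _ hne)
        simp [this, Pi.single_apply, hn.1]
      · have h1 := Finset.card_insert_le z (Finset.univ.image v)
        have h2 : (Finset.univ.image v).card ≤ r := Finset.card_image_le.trans (by simp)
        omega

end helpers

section helpers
open scoped Classical

variable {V : Type} [Fintype V] {G : SimpleGraph V}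

lemma dist_adj_le (x y z : V) (hr : G.Reachable x y) (h : G.Adj y z) : G.dist x z ≤ G.dist x y + 1 := by
  obtain ⟨w, hw⟩ := hr.exists_walk_length_eq_dist
  have := SimpleGraph.dist_le (w.concat h)
  rw [SimpleGraph.Walk.length_concat, hw] at this
  exact this

lemma dist_pred (x y : V) (m : ℕ) (h : G.dist x y = m + 1) : ∃ p, G.Adj p y ∧ G.dist x p = m := by
  have hr : G.Reachable y x := (SimpleGraph.Reachable.of_dist_ne_zero (by omega : G.dist x y ≠ 0)).symm
  obtain ⟨w, hw⟩ := hr.exists_walk_length_eq_dist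
  rw [SimpleGraph.dist_comm, h] at hw
  cases w with
  | nil => simp at hw
  | cons hadj p =>
    rename_i v
    refine ⟨v, hadj.symm, ?_⟩
    simp at hw
    have h1 := SimpleGraph.dist_le p
    rw [hw, SimpleGraph.dist_comm] at h1
    have h2 := dist_adj_le x v y p.reachable.symm hadj.symm
    omega

lemma dist_exact (x y : V) (k m : ℕ) (h : G.dist x y = k + m) : ∃ p, G.dist x p = k := by
  induction m generalizing y with
  | zero => exact ⟨y, h⟩
  | succ m ih =>
    obtain ⟨p, _, hp⟩ := dist_pred x y (k + m) h
    exact ih p hp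

noncomputable def dg (G : SimpleGraph V) (x : V) : ℕ := (Finset.univ.filter fun y => G.Adj x y).card

/-- component decomposition -/
lemma exists_comp (x : V → ℝ) (hx : Qf G x x < 0) : ∃ C h, Comp G C h := by
  set h0 : V → ℝ := |x| with hh0
  have hneg : Qf G h0 h0 < 0 := (Qf_abs_le G x).trans_lt hx
  letI : Fintype G.ConnectedComponent := Fintype.ofFinite _
  set hc : G.ConnectedComponent → V → ℝ := fun κ i => if G.connectedComponentMk i = κ then h0 i else 0 with hhc
  have hQ : ∀ κ, Qf G (hc κ) (hc κ) = ∑ i, if G.connectedComponentMk i = κ then h0 i * QV G h0 i else 0 := by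
    intro κ
    rw [Qf_eq_QV]
    refine Finset.sum_congr rfl fun i _ => ?_
    by_cases hi : G.connectedComponentMk i = κ
    · have : QV G (hc κ) i = QV G h0 i := by
        unfold QV
        have e : ∑ j, aG G i j * hc κ j = ∑ j, aG G i j * h0 j := by
          refine Finset.sum_congr rfl fun j _ => ?_
          by_cases hj : G.Adj i j
          · have : G.connectedComponentMk j = κ := by
              rw [← hi]; exact (SimpleGraph.ConnectedComponent.connectedComponentMk_eq_of_adj hj).symm
            simp [hhc, this]
          · simp [aG, hj]
        rw [e]; simp [hhc, hi]
      rw [this]; simp [hhc, hi]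
    · simp [hhc, hi]
  have hsum : ∑ κ, Qf G (hc κ) (hc κ) = Qf G h0 h0 := by
    simp only [hQ]
    rw [Finset.sum_comm, Qf_eq_QV]
    exact Finset.sum_congr rfl fun i _ => by simp
  obtain ⟨κ, hκ⟩ : ∃ κ, Qf G (hc κ) (hc κ) < 0 := by
    by_contra hno
    push Not at hno
    have := Finset.sum_nonneg (s := Finset.univ) fun κ _ => hno κ
    linarith
  refine ⟨Finset.univ.filter fun i => G.connectedComponentMk i = κ, hc κ, ?_, ?_, ?_, ?_, hκ⟩
  · intro x hx y hxy
    simp only [Finset.mem_filter, Finset.mem_univ, true_and] at hx ⊢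
    rw [← hx]; exact (SimpleGraph.ConnectedComponent.connectedComponentMk_eq_of_adj hxy).symm
  · intro x hx y hy
    simp only [Finset.mem_filter, Finset.mem_univ, true_and] at hx hy
    exact SimpleGraph.ConnectedComponent.exact (hx.trans hy.symm)
  · intro i
    simp only [hhc, hh0, Pi.abs_apply]
    split_ifs
    · exact abs_nonneg _
    · exact le_rfl
  · intro i hi
    simp only [Finset.mem_filter, Finset.mem_univ, true_and]
    by_contra hne
    exact hi (by simp [hhc, hne])

/-- certificate weights -/
noncomputable def wt (G : SimpleGraph V) (i j : V) : ℝ :=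
  if dg G i = 1 ∧ dg G j = 3 then 2 else if dg G i = 3 ∧ dg G j = 1 then 1 / 2 else 1

lemma wt_ineq (i j : V) (a b : ℝ) : 2 * (a * b) ≤ wt G i j * a ^ 2 + wt G j i * b ^ 2 := by
  unfold wt
  by_cases h1 : dg G i = 1 ∧ dg G j = 3
  · simp [h1.1, h1.2]; nlinarith [sq_nonneg (2 * a - b)]
  · by_cases h2 : dg G i = 3 ∧ dg G j = 1
    · simp [h2.1, h2.2]; nlinarith [sq_nonneg (a - 2 * b)]
    · have h1' : ¬ (dg G j = 3 ∧ dg G i = 1) := fun h => h1 ⟨h.2, h.1⟩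
      have h2' : ¬ (dg G j = 1 ∧ dg G i = 3) := fun h => h2 ⟨h.2, h.1⟩
      rw [if_neg h1, if_neg h2, if_neg h2', if_neg h1']
      nlinarith [sq_nonneg (a - b)]

lemma sum_aG (i : V) : ∑ j, aG G i j = dg G i := by
  unfold aG dg; simp

lemma Comp.bad {C : Finset V} {h : V → ℝ} (hC : Comp G C h) (hd : ∀ x ∈ C, dg G x ≤ 3) :
    ∃ x ∈ C, dg G x = 3 ∧ (Finset.univ.filter fun y => G.Adj x y ∧ dg G y = 1).card ≤ 1 := by
  by_contra hno
  push Not at hno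
  have hw : ∀ i ∈ C, ∑ j, aG G i j * wt G i j ≤ 2 := by
    intro i hi
    have h3 := hd i hi
    by_cases e3 : dg G i = 3
    · have h2 := hno i hi e3
      have e : ∀ j, aG G i j * wt G i j = aG G i j - (1/2) * (if G.Adj i j ∧ dg G j = 1 then 1 else 0) := by
        intro j
        unfold wt aG
        by_cases hj : G.Adj i j <;> by_cases hl : dg G j = 1 <;> simp [hj, hl, e3]
        norm_num
      simp only [e]
      rw [Finset.sum_sub_distrib, ← Finset.mul_sum, sum_aG, e3]
      simp only [Finset.sum_boole]
      have : (2:ℝ) ≤ ((Finset.univ.filter fun y => G.Adj i y ∧ dg G y = 1).card : ℝ) := by exact_mod_cast h2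
      push_cast
      linarith
    · by_cases e1 : dg G i = 1
      · have : ∑ j, aG G i j * wt G i j ≤ ∑ j, aG G i j * 2 := by
          refine Finset.sum_le_sum fun j _ => mul_le_mul_of_nonneg_left ?_ (aG_nonneg _ _ _)
          unfold wt; split_ifs <;> norm_num
        rw [← Finset.sum_mul, sum_aG, e1] at this
        simpa using this
      · have : ∑ j, aG G i j * wt G i j = ∑ j, aG G i j := by
          refine Finset.sum_congr rfl fun j _ => ?_
          unfold wt; simp [e1, e3]
        rw [this, sum_aG]
        have : dg G i ≤ 2 := by omega
        exact_mod_cast this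
  have hneg := hC.neg
  have key : 2 * ∑ i, ∑ j, aG G i j * h i * h j ≤ 2 * ∑ i, h i ^ 2 * ∑ j, aG G i j * wt G i j := by
    have s1 : 2 * ∑ i, ∑ j, aG G i j * h i * h j ≤
        ∑ i, ∑ j, (aG G i j * wt G i j * h i ^ 2 + aG G i j * wt G j i * h j ^ 2) := by
      rw [Finset.mul_sum]
      refine Finset.sum_le_sum fun i _ => ?_
      rw [Finset.mul_sum]
      refine Finset.sum_le_sum fun j _ => ?_
      have := mul_le_mul_of_nonneg_left (wt_ineq (G := G) i j (h i) (h j)) (aG_nonneg G i j)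
      linarith
    have s2 : ∑ i, ∑ j, aG G i j * wt G j i * h j ^ 2 = ∑ i, ∑ j, aG G i j * wt G i j * h i ^ 2 := by
      rw [Finset.sum_comm]
      refine Finset.sum_congr rfl fun i _ => Finset.sum_congr rfl fun j _ => ?_
      rw [aG_symm]
    have s3 : ∑ i, ∑ j, aG G i j * wt G i j * h i ^ 2 = ∑ i, h i ^ 2 * ∑ j, aG G i j * wt G i j := by
      refine Finset.sum_congr rfl fun i _ => ?_
      rw [← Finset.sum_mul, mul_comm]
    simp only [Finset.sum_add_distrib] at s1
    rw [s2, s3] at s1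
    linarith
  have key2 : ∑ i, h i ^ 2 * ∑ j, aG G i j * wt G i j ≤ ∑ i, 2 * (h i * h i) := by
    refine Finset.sum_le_sum fun i _ => ?_
    by_cases hi : i ∈ C
    · have := mul_le_mul_of_nonneg_left (hw i hi) (sq_nonneg (h i))
      linarith
    · have : h i = 0 := by
        by_contra hne; exact hi (hC.supp i hne)
      simp [this]
  rw [← Finset.mul_sum] at key2
  unfold Qf at hneg
  linarith

lemma sphere_bound {C : Finset V} (x : V) (hx : x ∈ C) (hcl : ∀ x ∈ C, ∀ y, G.Adj x y → y ∈ C)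
    (hcn : ∀ x ∈ C, ∀ y ∈ C, G.Reachable x y) (hd : ∀ x ∈ C, dg G x ≤ 3) (j : ℕ) :
    (C.filter fun y => G.dist x y = j + 2).card ≤ (C.filter fun y => G.dist x y = j + 1).card * 2 := by
  have hsub : (C.filter fun y => G.dist x y = j + 2) ⊆ (C.filter fun y => G.dist x y = j + 1).biUnion
      fun s => Finset.univ.filter fun y => G.Adj s y ∧ G.dist x y = j + 2 := by
    intro y hy
    simp only [Finset.mem_filter] at hy
    obtain ⟨p, hp, hpd⟩ := dist_pred x y (j + 1) hy.2
    simp only [Finset.mem_biUnion, Finset.mem_filter, Finset.mem_univ, true_and]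
    exact ⟨p, ⟨hcl y hy.1 p hp.symm, hpd⟩, hp, hy.2⟩
  refine (Finset.card_le_card hsub).trans (Finset.card_biUnion_le_card_mul _ _ _ fun s hs => ?_)
  simp only [Finset.mem_filter] at hs
  obtain ⟨p, hp, hpd⟩ := dist_pred x s j hs.2
  have h3 := hd s hs.1
  unfold dg at h3
  have hlt : (Finset.univ.filter fun y => G.Adj s y ∧ G.dist x y = j + 2) ⊆ (Finset.univ.filter fun y => G.Adj s y).erase p := by
    intro y hy
    simp only [Finset.mem_filter, Finset.mem_univ, true_and, Finset.mem_erase] at hy ⊢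
    refine ⟨?_, hy.1⟩
    rintro rfl
    omega
  have h4 := Finset.card_le_card hlt
  rw [Finset.card_erase_of_mem (by simpa using hp.symm)] at h4
  omega

lemma ball_bound {C : Finset V} (x : V) (hx : x ∈ C) (hcl : ∀ x ∈ C, ∀ y, G.Adj x y → y ∈ C)
    (hcn : ∀ x ∈ C, ∀ y ∈ C, G.Reachable x y) (hd : ∀ x ∈ C, dg G x ≤ 3)
    (h4 : ∀ y ∈ C, G.dist x y ≤ 4) : C.card ≤ 46 := by
  have h0 : (C.filter fun y => G.dist x y = 0) ⊆ {x} := by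
    intro y hy
    simp only [Finset.mem_filter] at hy
    have := (hcn x hx y hy.1).dist_eq_zero_iff.mp hy.2
    simp [this]
  have h1 : (C.filter fun y => G.dist x y = 0 + 1) ⊆ Finset.univ.filter fun y => G.Adj x y := by
    intro y hy
    simp only [Finset.mem_filter, Finset.mem_univ, true_and] at hy ⊢
    exact SimpleGraph.dist_eq_one_iff_adj.mp hy.2
  have c0 := Finset.card_le_card h0
  have c1 := (Finset.card_le_card h1).trans (hd x hx)
  have c2 := sphere_bound x hx hcl hcn hd 0
  have c3 := sphere_bound x hx hcl hcn hd 1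
  have c4 := sphere_bound x hx hcl hcn hd 2
  have hsub : C ⊆ (Finset.range 5).biUnion fun j => C.filter fun y => G.dist x y = j := by
    intro y hy
    simp only [Finset.mem_biUnion, Finset.mem_range, Finset.mem_filter]
    exact ⟨_, by have := h4 y hy; omega, hy, rfl⟩
  have := (Finset.card_le_card hsub).trans Finset.card_biUnion_le
  simp only [Finset.sum_range_succ, Finset.sum_range_zero] at this
  simp only [Finset.card_singleton] at c0
  norm_num at *
  omega

end helpers

section helpers
open scoped Classical

variable {V : Type} [Fintype V] {G : SimpleGraph V}

lemma Comp.branch {C : Finset V} {h : V → ℝ} (hC : Comp G C h)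
    (hd : ∀ x, (Finset.univ.filter fun y => G.Adj x y).card ≤ 4)
    (x q q' p1 p2 p3 p4 p5 : V) (hx : x ∈ C) (hq : G.Adj x q) (hq' : G.Adj x q') (hp1 : G.Adj x p1)
    (hN : ∀ y, G.Adj x y → y = p1 ∨ y = q ∨ y = q')
    (n1 : q ≠ q') (n2 : q ≠ p1) (n3 : q' ≠ p1)
    (h12 : G.Adj p1 p2) (h23 : G.Adj p2 p3) (h34 : G.Adj p3 p4) (h45 : G.Adj p4 p5)
    (d2 : G.dist x p2 = 2) (d3 : G.dist x p3 = 3) (d4 : G.dist x p4 = 4) (d5 : G.dist x p5 = 5)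
    (hleaf : dg G q ≠ 1) : Good G := by
  obtain ⟨q2, hq2, hq2x⟩ : ∃ q2, G.Adj q q2 ∧ q2 ≠ x := by
    by_contra hno
    push Not at hno
    apply hleaf
    unfold dg
    rw [Finset.card_eq_one]
    refine ⟨x, ?_⟩
    ext y
    simp only [Finset.mem_filter, Finset.mem_univ, true_and, Finset.mem_singleton]
    exact ⟨hno y, fun h => h ▸ hq.symm⟩
  have tri : ∀ a b : V, G.Adj x a → G.Adj x b → G.Adj a b → Good G := by
    intro a b ha hb hab
    refine hC.ext hd (r := 3) (by norm_num) ![x, a, b] ?_ ![1,1,1] (by decide) {(0,1),(0,2),(1,2)} (by decide) ?_ (by decide) 0 hx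
    · rw [← List.nodup_ofFn]
      simp [ha.ne, hb.ne, hab.ne]
    · intro p hp
      simp only [Finset.mem_insert, Finset.mem_singleton] at hp
      rcases hp with rfl | rfl | rfl
      exacts [ha, hb, hab]
  have dq : G.dist x q = 1 := SimpleGraph.dist_eq_one_iff_adj.mpr hq
  have dq' : G.dist x q' = 1 := SimpleGraph.dist_eq_one_iff_adj.mpr hq'
  have d1 : G.dist x p1 = 1 := SimpleGraph.dist_eq_one_iff_adj.mpr hp1
  have d0 : G.dist x x = 0 := SimpleGraph.dist_self
  by_cases hadj : G.Adj x q2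
  · exact tri q q2 hq hadj hq2
  have dq2 : G.dist x q2 = 2 := by
    have h1 := dist_adj_le x q q2 hq.reachable hq2
    have h2 : G.dist x q2 ≠ 1 := fun h => hadj (SimpleGraph.dist_eq_one_iff_adj.mp h)
    have h3 : G.dist x q2 ≠ 0 := by
      intro h
      exact hq2x ((hq.reachable.trans hq2.reachable).dist_eq_zero_iff.mp h).symm
    omega
  have ne_of : ∀ a b : V, G.dist x a ≠ G.dist x b → a ≠ b := by
    rintro a b h rfl; exact h rfl
  by_cases hq2p : q2 = p2
  · subst hq2p
    refine hC.ext hd (r := 4) (by norm_num) ![x, q, q2, p1] ?_ ![1,1,1,1] (by decide) {(0,1),(1,2),(2,3),(0,3)} (by decide) ?_ (by decide) 0 hx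
    · rw [← List.nodup_ofFn]
      simp [hq.ne, hq2.ne, n2, h12.ne.symm, hq2x.symm, hp1.ne]
    · intro p hp
      simp only [Finset.mem_insert, Finset.mem_singleton] at hp
      rcases hp with rfl | rfl | rfl | rfl
      exacts [hq, hq2, h12.symm, hp1]
  · refine hC.ext hd (r := 9) (by norm_num) ![x, q', q, q2, p1, p2, p3, p4, p5] ?_ ![6,3,4,2,5,4,3,2,1] (by decide)
      {(0,1),(0,2),(2,3),(0,4),(4,5),(5,6),(6,7),(7,8)} (by decide) ?_ (by decide) 0 hx
    · rw [← List.nodup_ofFn]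
      simp only [List.ofFn_succ, List.ofFn_zero, List.nodup_cons, List.mem_cons, List.not_mem_nil, not_or,
        Matrix.cons_val_zero, Matrix.cons_val_succ, List.nodup_nil, not_false_eq_true, and_true, or_false]
      refine ⟨⟨?_, ?_, ?_, ?_, ?_, ?_, ?_, ?_⟩, ⟨n1.symm, ?_, n3, ?_, ?_, ?_, ?_⟩, ⟨?_, n2, ?_, ?_, ?_, ?_⟩,
        ⟨?_, hq2p, ?_, ?_, ?_⟩, ⟨?_, ?_, ?_, ?_⟩, ⟨?_, ?_, ?_⟩, ⟨?_, ?_⟩, ?_⟩ <;> apply ne_of <;> omega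
    · intro p hp
      simp only [Finset.mem_insert, Finset.mem_singleton] at hp
      rcases hp with rfl | rfl | rfl | rfl | rfl | rfl | rfl | rfl
      exacts [hq', hq, hq2, hp1, h12, h23, h34, h45]

theorem caseC4 (hd : ∀ x, (Finset.univ.filter fun y => G.Adj x y).card ≤ 4) (f : V → ℝ) (hf : Qf G f f < 0) : Good G := by
  obtain ⟨C, h, hC⟩ := exists_comp f hf
  by_cases h4 : ∃ x ∈ C, 4 ≤ dg G x
  · obtain ⟨x, hx, hx4⟩ := h4
    obtain ⟨v, hv, hv0, hadj⟩ := star_enum x 4 hx4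
    refine hC.ext hd (by norm_num) v hv ![2,1,1,1,1] (by decide) {(0,1),(0,2),(0,3),(0,4)} (by decide) ?_ (by decide) 0 (hv0 ▸ hx)
    intro p hp
    simp only [Finset.mem_insert, Finset.mem_singleton] at hp
    rcases hp with rfl | rfl | rfl | rfl <;> simp only [hv0]
    exacts [hadj 0, hadj 1, hadj 2, hadj 3]
  have h3 : ∀ x ∈ C, dg G x ≤ 3 := by
    intro x hx
    by_contra hc
    exact h4 ⟨x, hx, by omega⟩
  obtain ⟨x, hx, hx3, hxl⟩ := hC.bad h3
  by_cases hball : ∀ y ∈ C, G.dist x y ≤ 4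
  · exact hC.good ((ball_bound x hx hC.closed hC.conn h3 hball).trans (by norm_num))
  push Not at hball
  obtain ⟨y, hy, hy5⟩ := hball
  obtain ⟨p5, d5⟩ := dist_exact (G := G) x y 5 (G.dist x y - 5) (by omega)
  obtain ⟨p4, h45, d4⟩ := dist_pred x p5 4 d5
  obtain ⟨p3, h34, d3⟩ := dist_pred x p4 3 d4
  obtain ⟨p2, h23, d2⟩ := dist_pred x p3 2 d3
  obtain ⟨p1, h12, d1⟩ := dist_pred x p2 1 d2
  have hp1 : G.Adj x p1 := SimpleGraph.dist_eq_one_iff_adj.mp d1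
  have hNc : ((Finset.univ.filter fun y => G.Adj x y).erase p1).card = 2 := by
    rw [Finset.card_erase_of_mem (by simpa using hp1)]
    unfold dg at hx3; omega
  obtain ⟨q, q', hqq, hNe⟩ := Finset.card_eq_two.mp hNc
  have hmem : ∀ y, (y ≠ p1 ∧ G.Adj x y) ↔ (y = q ∨ y = q') := by
    intro y
    have := Finset.ext_iff.mp hNe y
    simpa using this
  have hq := (hmem q).mpr (Or.inl rfl)
  have hq' := (hmem q').mpr (Or.inr rfl)
  have hN : ∀ y, G.Adj x y → y = p1 ∨ y = q ∨ y = q' := by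
    intro y hy
    by_cases h : y = p1
    · exact Or.inl h
    · exact Or.inr ((hmem y).mp ⟨h, hy⟩)
  by_cases hl : dg G q = 1
  · have hl' : dg G q' ≠ 1 := by
      intro hl'
      have : ({q, q'} : Finset V) ⊆ Finset.univ.filter fun y => G.Adj x y ∧ dg G y = 1 := by
        intro y hy
        simp only [Finset.mem_insert, Finset.mem_singleton] at hy
        rcases hy with rfl | rfl
        · simp [hq.2, hl]
        · simp [hq'.2, hl']
      have := Finset.card_le_card this
      rw [Finset.card_pair hqq] at this
      omega
    exact hC.branch hd x q' q p1 p2 p3 p4 p5 hx hq'.2 hq.2 hp1 (fun y hy => by have := hN y hy; tauto) hqq.symm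
      hq'.1 hq.1 h12 h23 h34 h45 d2 d3 d4 d5 hl'
  · exact hC.branch hd x q q' p1 p2 p3 p4 p5 hx hq.2 hq'.2 hp1 hN hqq
      hq.1 hq'.1 h12 h23 h34 h45 d2 d3 d4 d5 hl

theorem Setup.main {U : Finset V} (hS : Setup G U) : (∀ x, 0 ≤ Qf G x x) ∨ Good G := by
  by_cases h5 : ∃ y, y ∉ U ∧ kk G U y = 5
  · obtain ⟨y, hy, hy5⟩ := h5
    exact Or.inr (hS.caseA y hy hy5)
  have h4 : ∀ y, y ∉ U → kk G U y ≤ 4 := by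
    intro y hy
    by_contra hc
    have h1 := kk_int (G := G) (U := U) y 4 (by exact_mod_cast hc)
    have h2 := hS.hk y hy
    push_cast at h1
    exact h5 ⟨y, hy, by linarith⟩
  by_cases hB : ∃ y z, y ∉ U ∧ z ∉ U ∧ y ≠ z ∧ BB G U y z ≠ 0 ∧ kk G U y = 4
  · obtain ⟨y, z, hy, hz, hyz, hb, hk⟩ := hB
    exact Or.inr (hS.caseB h4 y hy hk z hz hyz hb)
  have hC : ∀ y z, y ∉ U → z ∉ U → y ≠ z → BB G U y z ≠ 0 → kk G U y ≤ 3 := by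
    intro y z hy hz hyz hb
    by_contra hc
    have h1 := kk_int (G := G) (U := U) y 3 (by exact_mod_cast hc)
    have h2 := h4 y hy
    push_cast at h1
    exact hB ⟨y, z, hy, hz, hyz, hb, by linarith⟩
  have hd := hS.deg h4 hC
  by_cases h5' : ∃ x, 5 ≤ (Finset.univ.filter fun y => G.Adj x y).card
  · obtain ⟨x, hx⟩ := h5'
    exact Or.inr (caseC3 hd x hx)
  have hd4 : ∀ x, (Finset.univ.filter fun y => G.Adj x y).card ≤ 4 := by
    intro x
    by_contra hc
    exact h5' ⟨x, by omega⟩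
  by_cases hQ : ∀ x, 0 ≤ Qf G x x
  · exact Or.inl hQ
  · push Not at hQ
    obtain ⟨f, hf⟩ := hQ
    exact Or.inr (caseC4 hd4 f hf)

end helpers

section helpers
open scoped Classical
open Matrix

variable {V : Type} [Fintype V] {G : SimpleGraph V}

noncomputable def MM (G : SimpleGraph V) : Matrix V V ℝ :=
  Matrix.of fun i j => 1 + (if i = j then 4 else 0) - 2 * aG G i j

noncomputable def QM (G : SimpleGraph V) : Matrix V V ℝ :=
  Matrix.of fun i j => (if i = j then 4 else 0) - 2 * aG G i j

lemma QM_mulVec (x : V → ℝ) (i : V) : (QM G *ᵥ x) i = QV G x i := by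
  simp only [Matrix.mulVec, dotProduct, QM, Matrix.of_apply, sub_mul, Finset.sum_sub_distrib, QV, Finset.mul_sum]
  congr 1
  · simp
  · exact Finset.sum_congr rfl fun _ _ => by ring

lemma MM_mulVec (x : V → ℝ) (i : V) : (MM G *ᵥ x) i = ∑ j, x j + QV G x i := by
  rw [← QM_mulVec]
  simp only [Matrix.mulVec, dotProduct, QM, MM, Matrix.of_apply]
  rw [← Finset.sum_add_distrib]
  exact Finset.sum_congr rfl fun _ _ => by ring

lemma ker_MM (v : V → ℝ) (hv : v ∈ LinearMap.ker (MM G).mulVecLin) (i : V) : QV G v i = - ∑ j, v j := by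
  have := congrFun (LinearMap.mem_ker.mp hv) i
  rw [Matrix.mulVecLin_apply, MM_mulVec] at this
  simp at this; linarith

lemma ker_MM_Q (v : V → ℝ) (hv : v ∈ LinearMap.ker (MM G).mulVecLin) : Qf G v v = - (∑ j, v j) ^ 2 := by
  rw [Qf_eq_QV]
  simp only [ker_MM v hv]
  rw [← Finset.sum_mul]; ring

lemma rank_nullity (A : Matrix V V ℝ) :
    A.rank + Module.finrank ℝ (LinearMap.ker A.mulVecLin) = Fintype.card V := by
  have := LinearMap.finrank_range_add_finrank_ker A.mulVecLin
  simpa [Matrix.rank] using this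

lemma rank_good (hM : PSDM G) (hG : Good G) : Fintype.card V ≤ (MM G).rank + 91 := by
  obtain ⟨h, h0, hneg, hcard⟩ := hG
  set D := Finset.univ.filter fun i => QV G h i ≠ 0 with hD
  have hsh : 0 < ∑ i, h i := by
    rcases (Finset.sum_nonneg fun i (_ : i ∈ Finset.univ) => h0 i).lt_or_eq with hlt | heq
    · exact hlt
    · have hz := (Finset.sum_eq_zero_iff_of_nonneg fun i _ => h0 i).mp heq.symm
      have : Qf G h h = 0 := by
        rw [Qf_eq_QV]; exact Finset.sum_eq_zero fun i hi => by rw [hz i hi]; simp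
      linarith
  have key : ∀ v ∈ LinearMap.ker (MM G).mulVecLin, (∀ i ∈ D, v i = 0) → v = 0 := by
    intro v hv hvD
    by_contra hne
    have hp : Qf G |v| |v| ≤ 0 := by
      have := Qf_abs_le G v
      rw [ker_MM_Q v hv] at this
      nlinarith [sq_nonneg (∑ j, v j)]
    have hph : Qf G |v| h = 0 := by
      rw [Qf_eq_QV]
      refine Finset.sum_eq_zero fun i _ => ?_
      by_cases hi : i ∈ D
      · simp [hvD i hi]
      · have : QV G h i = 0 := by simpa [hD] using hi
        simp [this]
    have hsp : 0 < ∑ i, |v| i := by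
      obtain ⟨i, hi⟩ := Function.ne_iff.mp hne
      exact Finset.sum_pos' (fun i _ => abs_nonneg (v i)) ⟨i, Finset.mem_univ i, abs_pos.mpr (by simpa using hi)⟩
    set c := (∑ i, |v| i) / ∑ i, h i with hc
    have hcpos : 0 < c := div_pos hsp hsh
    have h1 := hM (|v| + (-c) • h)
    have hsum : ∑ i, (|v| + (-c) • h) i = 0 := by
      simp only [Pi.add_apply, Pi.smul_apply, smul_eq_mul, Finset.sum_add_distrib, ← Finset.mul_sum]
      have : c * ∑ i, h i = ∑ i, |v| i := by rw [hc]; field_simp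
      linarith
    rw [hsum, Qf_add_left, Qf_add_right, Qf_add_right, Qf_smul_left, Qf_smul_left, Qf_smul_right, Qf_smul_right, Qf_symm G h,
      hph] at h1
    have : c * c * Qf G h h < 0 := mul_neg_of_pos_of_neg (by positivity) hneg
    nlinarith
  let R : LinearMap.ker (MM G).mulVecLin →ₗ[ℝ] (D → ℝ) :=
    { toFun := fun v i => v.1 i
      map_add' := fun _ _ => rfl
      map_smul' := fun _ _ => rfl }
  have hR : Function.Injective R := by
    rw [injective_iff_map_eq_zero]
    intro v hv
    apply Subtype.ext
    refine key v.1 v.2 fun i hi => ?_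
    exact congrFun hv ⟨i, hi⟩
  have h2 := LinearMap.finrank_le_finrank_of_injective hR
  have h3 := rank_nullity (MM G)
  simp only [Module.finrank_fintype_fun_eq_card, Fintype.card_coe] at h2
  omega

lemma QM_herm : (QM G).IsHermitian := by
  ext i j
  simp [QM, aG_symm G j i, eq_comm]

lemma QM_form (x : V → ℝ) : x ⬝ᵥ (QM G *ᵥ x) = Qf G x x := by
  rw [Qf_eq_QV]
  exact Finset.sum_congr rfl fun i _ => by rw [QM_mulVec]

lemma trace_sq_eig (A : Matrix V V ℝ) (hA : A.IsHermitian) : (A * A).trace = ∑ i, hA.eigenvalues i ^ 2 := by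
  have h := hA.spectral_theorem
  set W : Matrix V V ℝ := (hA.eigenvectorUnitary : Matrix V V ℝ) with hW
  have hu : star W * W = 1 := Unitary.coe_star_mul_self hA.eigenvectorUnitary
  have hdef : A = W * diagonal hA.eigenvalues * star W := by
    conv_lhs => rw [h]
    rfl
  have : A * A = W * (diagonal hA.eigenvalues * diagonal hA.eigenvalues) * star W := by
    calc A * A = (W * diagonal hA.eigenvalues * star W) * (W * diagonal hA.eigenvalues * star W) := by rw [← hdef]
      _ = W * diagonal hA.eigenvalues * (star W * W) * diagonal hA.eigenvalues * star W := by noncomm_ring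
      _ = _ := by rw [hu]; noncomm_ring
  rw [this, Matrix.trace_mul_comm, ← Matrix.mul_assoc, hu, Matrix.one_mul, diagonal_mul_diagonal, trace_diagonal]
  exact Finset.sum_congr rfl fun i _ => by ring

lemma rank_QM (hQ : ∀ x, 0 ≤ Qf G x x) : 2 * (Fintype.card V : ℝ) / 3 ≤ (QM G).rank := by
  have hH := QM_herm (G := G)
  rcases Nat.eq_zero_or_pos (Fintype.card V) with h0 | hpos
  · rw [h0]; simp
  have hn : (0:ℝ) < Fintype.card V := by exact_mod_cast hpos
  set n : ℝ := ((Fintype.card V : ℕ) : ℝ) with hn'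
  have htr : ∑ i, hH.eigenvalues i = 4 * n := by
    have := hH.trace_eq_sum_eigenvalues
    have h2 : (QM G).trace = 4 * n := by
      simp [Matrix.trace, QM, aG_self, hn', mul_comm]
    rw [h2] at this
    simpa using this.symm
  have hA : ∑ i, ∑ j, aG G i j ≤ 2 * n := by
    have := hQ 1
    unfold Qf at this
    simp at this
    rw [← hn'] at this
    linarith
  have htr2 : ∑ i, hH.eigenvalues i ^ 2 ≤ 24 * n := by
    rw [← trace_sq_eig]
    have : (QM G * QM G).trace = ∑ i, ∑ j, ((if i = j then 16 else 0) + 4 * aG G i j) := by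
      simp only [Matrix.trace, Matrix.diag, Matrix.mul_apply]
      refine Finset.sum_congr rfl fun i _ => Finset.sum_congr rfl fun j _ => ?_
      simp only [QM, Matrix.of_apply]
      by_cases h : i = j
      · subst h; simp [aG_self]; norm_num
      · rw [aG_symm G j i]
        simp [h, Ne.symm h]
        have := aG_sq G i j
        linarith
    rw [this]
    simp only [Finset.sum_add_distrib, ← Finset.mul_sum]
    have : ∑ i : V, ∑ j : V, (if i = j then (16:ℝ) else 0) = 16 * n := by
      simp [hn', mul_comm]
    rw [this]; linarith
  have hrk : ((QM G).rank : ℝ) = ((Finset.univ.filter fun i => hH.eigenvalues i ≠ 0).card : ℝ) := by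
    rw [hH.rank_eq_card_non_zero_eigs, Fintype.card_subtype]
  have hcs := sq_sum_le_card_mul_sum_sq (s := Finset.univ.filter fun i => hH.eigenvalues i ≠ 0) (f := hH.eigenvalues)
  rw [← hrk] at hcs
  have e1 : ∑ i ∈ Finset.univ.filter (fun i => hH.eigenvalues i ≠ 0), hH.eigenvalues i = 4 * n := by
    rw [Finset.sum_filter_ne_zero, htr]
  have e2 : ∑ i ∈ Finset.univ.filter (fun i => hH.eigenvalues i ≠ 0), hH.eigenvalues i ^ 2 ≤ 24 * n :=
    (Finset.sum_le_sum_of_subset_of_nonneg (Finset.filter_subset _ _) fun _ _ _ => sq_nonneg _).trans htr2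
  rw [e1] at hcs
  have h3 : (4 * n) ^ 2 ≤ (QM G).rank * (24 * n) := hcs.trans (by gcongr)
  have : n * (16 * n) ≤ n * (24 * (QM G).rank) := by linarith
  have := le_of_mul_le_mul_left this hn
  linarith

lemma rank_psd (hn : 3 ≤ Fintype.card V) (hQ : ∀ x, 0 ≤ Qf G x x) :
    2 * (Fintype.card V : ℝ) / 3 + 1 ≤ (MM G).rank := by
  have hle : LinearMap.ker (MM G).mulVecLin ≤ LinearMap.ker (QM G).mulVecLin := by
    intro v hv
    have h1 := ker_MM_Q v hv
    have h2 := hQ v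
    have h3 : ∑ j, v j = 0 := by nlinarith [sq_nonneg (∑ j, v j)]
    rw [LinearMap.mem_ker, Matrix.mulVecLin_apply]
    ext i
    rw [QM_mulVec, ker_MM v hv, h3]; simp
  have r1 := rank_nullity (MM G)
  have r2 := rank_nullity (QM G)
  by_cases hb : LinearMap.ker (QM G).mulVecLin = ⊥
  · rw [hb] at hle
    have : LinearMap.ker (MM G).mulVecLin = ⊥ := le_bot_iff.mp hle
    rw [this] at r1
    simp at r1
    have h3 : (3:ℝ) ≤ Fintype.card V := by exact_mod_cast hn
    rw [r1]; linarith
  · obtain ⟨f, hf, hf0⟩ := Submodule.exists_mem_ne_zero_of_ne_bot hb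
    have hQf : Qf G f f = 0 := by
      rw [← QM_form]
      have : QM G *ᵥ f = 0 := hf
      rw [this]; simp
    have hPSD : (QM G).PosSemidef := .of_dotProduct_mulVec_nonneg QM_herm fun x => by
      have : star x = x := by ext; simp
      rw [this, QM_form]; exact hQ x
    have habs : Qf G |f| |f| = 0 := le_antisymm ((Qf_abs_le G f).trans hQf.le) (hQ _)
    have hk : QM G *ᵥ |f| = 0 := by
      refine (hPSD.dotProduct_mulVec_zero_iff |f|).mp ?_
      have : star |f| = |f| := by ext; simp
      rw [this, QM_form]; exact habs
    have hsp : 0 < ∑ i, |f| i := by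
      obtain ⟨i, hi⟩ := Function.ne_iff.mp hf0
      exact Finset.sum_pos' (fun i _ => abs_nonneg (f i)) ⟨i, Finset.mem_univ i, abs_pos.mpr (by simpa using hi)⟩
    have hnot : |f| ∉ LinearMap.ker (MM G).mulVecLin := by
      intro hmem
      have : Nonempty V := Fintype.card_pos_iff.mp (by omega)
      obtain ⟨i⟩ := this
      have h1 := ker_MM _ hmem i
      rw [← QM_mulVec, hk] at h1
      simp only [Pi.zero_apply] at h1
      linarith
    have hlt : LinearMap.ker (MM G).mulVecLin < LinearMap.ker (QM G).mulVecLin :=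
      lt_of_le_of_ne hle fun h => hnot (h ▸ hk)
    have := Submodule.finrank_lt_finrank_of_lt hlt
    have h3 : (QM G).rank + 1 ≤ (MM G).rank := by omega
    have h3' : ((QM G).rank : ℝ) + 1 ≤ (MM G).rank := by exact_mod_cast h3
    have := rank_QM hQ
    linarith

theorem rank_main {U : Finset V} (hS : Setup G U) (hn : 277 ≤ Fintype.card V) :
    2 * (Fintype.card V : ℝ) / 3 + 1 ≤ (MM G).rank := by
  rcases hS.main with h | h
  · exact rank_psd (by omega) h
  · have := rank_good hS.hM h
    have h1 : (Fintype.card V : ℝ) ≤ (MM G).rank + 91 := by exact_mod_cast this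
    have h2 : (277:ℝ) ≤ Fintype.card V := by exact_mod_cast hn
    linarith

end helpers

section helpers
open scoped Classical

lemma form_nonneg {n : ℕ} (S : Matrix (Fin n) (Fin n) ℝ) (hH : S.IsHermitian)
    (h : ∀ i, -5 ≤ hH.eigenvalues i) (x : Fin n → ℝ) :
    0 ≤ x ⬝ᵥ ((S + (5:ℝ) • (1 : Matrix (Fin n) (Fin n) ℝ)) *ᵥ x) := by
  have hsp := hH.spectral_theorem
  set W : Matrix (Fin n) (Fin n) ℝ := (hH.eigenvectorUnitary : Matrix (Fin n) (Fin n) ℝ) with hW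
  have hu : W * star W = 1 := Unitary.coe_mul_star_self hH.eigenvectorUnitary
  have hdef : S = W * diagonal hH.eigenvalues * star W := by
    conv_lhs => rw [hsp]
    rfl
  have hd : (diagonal fun i => hH.eigenvalues i + 5) = diagonal hH.eigenvalues + (5:ℝ) • (1 : Matrix (Fin n) (Fin n) ℝ) := by
    ext i j
    by_cases hij : i = j
    · subst hij; simp
    · simp [hij]
  have h2 : S + (5:ℝ) • (1 : Matrix (Fin n) (Fin n) ℝ) = W * (diagonal fun i => hH.eigenvalues i + 5) * Wᴴ := by
    rw [hd, mul_add, add_mul, ← Matrix.star_eq_conjTranspose, ← hdef]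
    simp [hu]
  have hp : (W * (diagonal fun i => hH.eigenvalues i + 5) * Wᴴ).PosSemidef := by
    apply PosSemidef.mul_mul_conjTranspose_same
    apply PosSemidef.diagonal
    intro i
    have := h i
    simp only [Pi.zero_apply]
    linarith
  rw [← h2] at hp
  simpa using hp.dotProduct_mulVec_nonneg x

/-- Sign attached to a vertex of the switching graph. -/
noncomputable def sgnS {n : ℕ} (x : Fin n ⊕ Fin n) : ℝ := Sum.elim (fun _ => 1) (fun _ => -1) x

/-- Projection of a vertex of the switching graph. -/
def prS {n : ℕ} (x : Fin n ⊕ Fin n) : Fin n := Sum.elim id id x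

lemma block_eq {n : ℕ} (S : Matrix (Fin n) (Fin n) ℝ) (x y : Fin n ⊕ Fin n) (h : prS x ≠ prS y) :
    Matrix.fromBlocks S (1 - S) (1 - S) S x y = sgnS x * sgnS y * S (prS x) (prS y) := by
  rcases x with x | x <;> rcases y with y | y <;> simp [prS, sgnS] at h ⊢ <;> simp [h]

lemma exists_signs {n : ℕ} (S : Matrix (Fin n) (Fin n) ℝ) (hS : IsSeidel S)
    (hα : 29 ≤ indepNum (switchGraph S)) :
    ∃ (U : Finset (Fin n)) (ε : Fin n → ℝ), U.card = 29 ∧ (∀ i, ε i = 1 ∨ ε i = -1) ∧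
      (∀ u ∈ U, ∀ v ∈ U, u ≠ v → ε u * ε v * S u v = 1) ∧
      (∀ y, y ∉ U → (U.filter fun u => ε u * ε y * S u y = -1).card ≤ 14) := by
  obtain ⟨hsym, hdiag, hpm⟩ := hS
  obtain ⟨s0, hs0⟩ := (switchGraph S)ᶜ.exists_isNClique_cliqueNum
  have hc0 : 29 ≤ s0.card := by rw [hs0.card_eq]; exact hα
  obtain ⟨s, hss, hsc⟩ := Finset.exists_subset_card_eq hc0
  have hcl : ∀ x ∈ s, ∀ y ∈ s, x ≠ y → ¬ (switchGraph S).Adj x y := by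
    intro x hx y hy hxy
    have := hs0.isClique (Finset.mem_coe.mpr (hss hx)) (Finset.mem_coe.mpr (hss hy)) hxy
    rw [SimpleGraph.compl_adj] at this
    exact this.2
  have hsg : ∀ x : Fin n ⊕ Fin n, sgnS x = 1 ∨ sgnS x = -1 := by
    rintro (x | x) <;> simp [sgnS]
  have hone : ∀ x ∈ s, ∀ y ∈ s, prS x ≠ prS y → sgnS x * sgnS y * S (prS x) (prS y) = 1 := by
    intro x hx y hy hxy
    have hne : x ≠ y := fun h => hxy (by rw [h])
    have h1 := hcl x hx y hy hne
    have h2 : sgnS x * sgnS y * S (prS x) (prS y) ≠ -1 := by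
      rw [← block_eq S x y hxy]
      intro h3
      apply h1
      rw [switchGraph, SimpleGraph.fromRel_adj]
      exact ⟨hne, Or.inl h3⟩
    rcases hsg x with a | a <;> rcases hsg y with b | b <;> rcases hpm _ _ hxy with c | c <;>
      rw [a, b, c] at h2 ⊢ <;> first | (exfalso; apply h2; norm_num; done) | norm_num
  have hinj : ∀ x ∈ s, ∀ y ∈ s, prS x = prS y → x = y := by
    intro x hx y hy hp
    by_contra hxy
    obtain ⟨z, hz, hzn⟩ : ∃ z ∈ s, z ∉ ({x, y} : Finset (Fin n ⊕ Fin n)) := by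
      apply Finset.exists_mem_notMem_of_card_lt_card
      have := Finset.card_le_two (a := x) (b := y)
      omega
    simp only [Finset.mem_insert, Finset.mem_singleton, not_or] at hzn
    have hzp : prS x ≠ prS z := by
      rcases x with x | x <;> rcases y with y | y <;> rcases z with z | z <;>
        simp [prS] at hp hxy hzn ⊢ <;> aesop
    have h1 := hone x hx z hz hzp
    have h2 := hone y hy z hz (hp ▸ hzp)
    rw [← hp] at h2
    have h3 : sgnS y = - sgnS x := by
      rcases x with x | x <;> rcases y with y | y <;> simp [prS, sgnS] at hp hxy ⊢ <;> try exact absurd hp hxy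
    rw [h3] at h2
    linarith
  set U := s.image prS with hU
  have hUc : U.card = 29 := by
    rw [hU, Finset.card_image_of_injOn, hsc]
    intro x hx y hy h
    exact hinj x hx y hy h
  let η : Fin n → ℝ := fun u => if Sum.inl u ∈ s then 1 else -1
  have hη : ∀ x ∈ s, η (prS x) = sgnS x := by
    rintro (x | x) hx
    · simp [η, prS, sgnS, hx]
    · have : Sum.inl x ∉ s := fun h => by
        have := hinj _ h _ hx rfl
        simp at this
      simp [η, prS, sgnS, this]
  have hηpm : ∀ u, η u = 1 ∨ η u = -1 := by
    intro u; by_cases h : Sum.inl u ∈ s <;> simp [η, h]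
  let ε : Fin n → ℝ := fun y => if y ∈ U then η y else
    if (U.filter fun u => η u * S u y = -1).card ≤ 14 then 1 else -1
  have hεU : ∀ u ∈ U, ε u = η u := fun u hu => by simp [ε, hu]
  refine ⟨U, ε, hUc, ?_, ?_, ?_⟩
  · intro i
    by_cases h : i ∈ U
    · rw [hεU i h]; exact hηpm i
    · by_cases h2 : (U.filter fun u => η u * S u i = -1).card ≤ 14
      · left; simp only [ε, if_neg h, if_pos h2]
      · right; simp only [ε, if_neg h, if_neg h2]
  · intro u hu v hv huv
    rw [hεU u hu, hεU v hv]
    obtain ⟨x, hx, rfl⟩ := Finset.mem_image.mp hu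
    obtain ⟨y, hy, rfl⟩ := Finset.mem_image.mp hv
    rw [hη x hx, hη y hy]
    exact hone x hx y hy huv
  · intro y hy
    have hcongr : (U.filter fun u => ε u * ε y * S u y = -1) = U.filter fun u => η u * ε y * S u y = -1 :=
      Finset.filter_congr fun u hu => by rw [hεU u hu]
    rw [hcongr]
    by_cases h2 : (U.filter fun u => η u * S u y = -1).card ≤ 14
    · have : ε y = 1 := by simp only [ε, if_neg hy, if_pos h2]
      rw [this]; simpa using h2
    · have : ε y = -1 := by simp only [ε, if_neg hy, if_neg h2]
      rw [this]
      have h3 := Finset.card_filter_add_card_filter_not (s := U) (fun u => η u * S u y = -1)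
      have h4 : (U.filter fun u => η u * -1 * S u y = -1).card ≤ (U.filter fun u => ¬ η u * S u y = -1).card := by
        apply Finset.card_le_card
        intro u hu
        simp only [Finset.mem_filter] at hu ⊢
        refine ⟨hu.1, fun h => ?_⟩
        have := hu.2
        linarith
      omega

theorem final_bound {n : ℕ} (S : Matrix (Fin n) (Fin n) ℝ) (hS : IsSeidel S)
    (hmin : minEig S = -5) (hn : 277 ≤ n)
    (hα : 29 ≤ indepNum (switchGraph S)) :
    2 * (n : ℝ) / 3 + 1 ≤ ((S + (5 : ℝ) • (1 : Matrix (Fin n) (Fin n) ℝ)).rank : ℝ) := by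
  obtain ⟨U, ε, hU, hε, hUU, h14⟩ := exists_signs S hS hα
  obtain ⟨hsym, hdiag, hpm⟩ := hS
  have hH : S.IsHermitian := by
    rw [Matrix.IsHermitian, Matrix.conjTranspose_eq_transpose_of_trivial]; exact hsym
  have heig : ∀ i, -5 ≤ hH.eigenvalues i := by
    intro i
    have h1 : (⨅ i, hH.eigenvalues i) = -5 := by
      rw [← hmin, minEig, dif_pos hH]
    rw [← h1]
    exact ciInf_le (Set.finite_range _).bddBelow i
  have hform := form_nonneg S hH heig
  have hss : ∀ i, ε i * ε i = 1 := by
    intro i; rcases hε i with h | h <;> rw [h] <;> norm_num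
  let G : SimpleGraph (Fin n) :=
    { Adj := fun i j => i ≠ j ∧ ε i * ε j * S i j = -1
      symm := ⟨fun i j h => ⟨h.1.symm, by
        have h1 : S j i = S i j := hsym.apply i j
        rw [h1, mul_comm (ε j)]; exact h.2⟩⟩
      loopless := ⟨fun i h => h.1 rfl⟩ }
  have hMM : MM G = Matrix.diagonal ε * (S + (5:ℝ) • (1 : Matrix (Fin n) (Fin n) ℝ)) * Matrix.diagonal ε := by
    ext i j
    rw [Matrix.mul_diagonal, Matrix.diagonal_mul]
    by_cases hij : i = j
    · subst hij
      have h1 := hss i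
      simp [MM, aG, hdiag]
      linarith
    · have h2 : ε i * ε j * S i j = 1 ∨ ε i * ε j * S i j = -1 := by
        rcases hε i with a | a <;> rcases hε j with b | b <;> rcases hpm _ _ hij with c | c <;>
          rw [a, b, c] <;> norm_num
      have h3 : ε i * (S + (5:ℝ) • (1 : Matrix (Fin n) (Fin n) ℝ)) i j * ε j = ε i * ε j * S i j := by
        simp [hij]; ring
      rw [h3]
      rcases h2 with h2 | h2
      · have hadj : ¬ G.Adj i j := fun h => by
          have := h.2
          linarith
        simp [MM, aG, hij, hadj, h2]
      · have hadj : G.Adj i j := ⟨hij, h2⟩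
        simp [MM, aG, hij, hadj, h2]
        norm_num
  have hM : PSDM G := by
    intro x
    have h1 := hform (Matrix.diagonal ε *ᵥ x)
    have h2 : x ⬝ᵥ (MM G *ᵥ x) = (∑ i, x i) ^ 2 + Qf G x x := by
      rw [Qf_eq_QV]
      simp only [dotProduct, MM_mulVec, mul_add, Finset.sum_add_distrib, ← Finset.sum_mul]
      ring
    rw [← h2, hMM, ← Matrix.mulVec_mulVec, ← Matrix.mulVec_mulVec, Matrix.dotProduct_mulVec,
      ← Matrix.mulVec_transpose, Matrix.diagonal_transpose]
    exact h1
  have hI : ∀ u ∈ U, ∀ v ∈ U, ¬ G.Adj u v := by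
    intro u hu v hv h
    have h1 := hUU u hu v hv h.1
    have h2 := h.2
    linarith
  have hk : ∀ y, y ∉ U → kk G U y ≤ 5 := by
    intro y hy
    apply kk_le_five hM hU hI y hy
    rw [kk_nat]
    have h1 : (U.filter fun u => G.Adj u y).card ≤ 14 := by
      refine le_trans (Finset.card_le_card ?_) (h14 y hy)
      intro u hu
      rw [Finset.mem_filter] at hu ⊢
      exact ⟨hu.1, hu.2.2⟩
    have h2 : (((U.filter fun u => G.Adj u y).card : ℕ) : ℝ) ≤ 14 := by exact_mod_cast h1
    convert h2
  have hr := rank_main (G := G) (U := U) ⟨hM, hU, hI, hk⟩ (by simpa using hn)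
  have hdet : IsUnit (Matrix.diagonal ε).det := by
    rw [Matrix.det_diagonal, isUnit_iff_ne_zero, Finset.prod_ne_zero_iff]
    intro i _ h0
    have := hss i
    rw [h0] at this
    norm_num at this
  rw [hMM, Matrix.rank_mul_eq_left_of_isUnit_det _ _ hdet, Matrix.rank_mul_eq_right_of_isUnit_det _ _ hdet,
    Fintype.card_fin] at hr
  exact hr

end helpers


/-- If `S` is a Seidel matrix of order `n ≥ 277` with smallest eigenvalue
exactly `-5`, `ω([S]) = 4` and `α([S]) ≥ 29`, then `rk(S + 5I) ≥ 2n/3 + 1`. -/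
theorem stmt_7 {n : ℕ} (S : Matrix (Fin n) (Fin n) ℝ) (hS : IsSeidel S)
    (hmin : minEig S = -5) (hn : 277 ≤ n)
    (hω : (switchGraph S).cliqueNum = 4)
    (hα : 29 ≤ indepNum (switchGraph S)) :
    2 * (n : ℝ) / 3 + 1 ≤ ((S + (5 : ℝ) • 1).rank : ℝ) := by
  exact final_bound S hS hmin hn hα
end

section
/- Let S be a Seidel matrix of order n ≥ 277 with smallest eigenvalue exactly −5. If the switching class of S contains a simple graph G whose maximum vertex degree is at most 16, then rk(S + 5I) ≥ 2n/3 + 1. -/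
open Matrix

namespace Aux

variable {n : ℕ}

open Classical in
noncomputable def Bv (G : SimpleGraph (Fin n)) (x : Fin n → ℝ) (i : Fin n) : ℝ :=
  2 * x i - ∑ j, if G.Adj i j then x j else 0

noncomputable def bl (G : SimpleGraph (Fin n)) (x y : Fin n → ℝ) : ℝ := ∑ i, x i * Bv G y i

open Classical in
noncomputable def nb (G : SimpleGraph (Fin n)) (i : Fin n) : Finset (Fin n) :=
  Finset.univ.filter fun j => G.Adj i j

theorem mem_nb (G : SimpleGraph (Fin n)) (i j : Fin n) : j ∈ nb G i ↔ G.Adj i j := by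
  simp [nb]

theorem Bv_eq (G : SimpleGraph (Fin n)) (x : Fin n → ℝ) (i : Fin n) :
    Bv G x i = 2 * x i - ∑ j ∈ nb G i, x j := by
  classical
  simp only [Bv, nb, Finset.sum_filter]

theorem Bv_comb (G : SimpleGraph (Fin n)) (x y : Fin n → ℝ) (s t : ℝ) (i : Fin n) :
    Bv G (fun k => s * x k + t * y k) i = s * Bv G x i + t * Bv G y i := by
  simp only [Bv_eq, Finset.sum_add_distrib, ← Finset.mul_sum]
  ring

theorem bl_symm (G : SimpleGraph (Fin n)) (x y : Fin n → ℝ) : bl G x y = bl G y x := by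
  classical
  simp only [bl, Bv, mul_sub, Finset.sum_sub_distrib, Finset.mul_sum]
  congr 1
  · exact Finset.sum_congr rfl fun i _ => by ring
  · rw [Finset.sum_comm]
    refine Finset.sum_congr rfl fun i _ => Finset.sum_congr rfl fun j _ => ?_
    by_cases h : G.Adj i j
    · simp [h, h.symm, mul_comm]
    · have h' : ¬ G.Adj j i := fun h' => h h'.symm
      simp [h, h']

theorem bl_comb_right (G : SimpleGraph (Fin n)) (z x y : Fin n → ℝ) (s t : ℝ) :
    bl G z (fun k => s * x k + t * y k) = s * bl G z x + t * bl G z y := by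
  simp only [bl, Bv_comb, Finset.mul_sum, ← Finset.sum_add_distrib]
  exact Finset.sum_congr rfl fun i _ => by ring

theorem q_comb (G : SimpleGraph (Fin n)) (x y : Fin n → ℝ) (s t : ℝ) :
    bl G (fun k => s * x k + t * y k) (fun k => s * x k + t * y k)
      = s ^ 2 * bl G x x + 2 * s * t * bl G x y + t ^ 2 * bl G y y := by
  rw [bl_comb_right, bl_symm G _ x, bl_symm G _ y, bl_comb_right, bl_comb_right, bl_symm G y x]
  ring

theorem sum_comb (x y : Fin n → ℝ) (s t : ℝ) :
    ∑ k, (s * x k + t * y k) = s * ∑ k, x k + t * ∑ k, y k := by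
  simp [Finset.sum_add_distrib, Finset.mul_sum]

/-- Positive semidefiniteness of `J + 2(2I - A)`. -/
def PSD (G : SimpleGraph (Fin n)) : Prop := ∀ x : Fin n → ℝ, 0 ≤ (∑ i, x i) ^ 2 + 2 * bl G x x

def Ker (G : SimpleGraph (Fin n)) (x : Fin n → ℝ) : Prop := ∀ i, ∑ k, x k + 2 * Bv G x i = 0

theorem Ker.q {G : SimpleGraph (Fin n)} {x : Fin n → ℝ} (h : Ker G x) :
    (∑ i, x i) ^ 2 + 2 * bl G x x = 0 := by
  have : ∑ i, x i * (∑ k, x k + 2 * Bv G x i) = 0 := Finset.sum_eq_zero fun i _ => by rw [h i]; simp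
  rw [← this, bl, sq, Finset.sum_mul, Finset.mul_sum, ← Finset.sum_add_distrib]
  exact Finset.sum_congr rfl fun i _ => by ring

theorem zero_lem {G : SimpleGraph (Fin n)} (P : PSD G) {x : Fin n → ℝ} (hs : ∑ i, x i = 0)
    (hq : bl G x x = 0) (i : Fin n) : Bv G x i = 0 := by
  set y : Fin n → ℝ := fun i => Bv G x i with hy
  set β : ℝ := ∑ i, (Bv G x i) ^ 2 with hβ
  have hb : bl G x y = β := by
    rw [bl_symm, hβ, bl]
    exact Finset.sum_congr rfl fun i _ => by simp [hy, sq]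
  have h0 : 0 ≤ β := Finset.sum_nonneg fun i _ => sq_nonneg _
  set c : ℝ := (∑ i, y i) ^ 2 + 2 * bl G y y with hc
  have hc0 : 0 ≤ c := P y
  have key : ∀ t : ℝ, 0 ≤ t ^ 2 * c + 4 * t * β := by
    intro t
    have := P (fun k => 1 * x k + t * y k)
    rw [q_comb, sum_comb, hs, hq, hb] at this
    rw [hc]; nlinarith
  have hb0 : β = 0 := by
    by_contra hne
    have hp : 0 < β := lt_of_le_of_ne h0 (Ne.symm hne)
    have := key (-(β / (c + 1)))
    have hd : 0 < c + 1 := by linarith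
    have e : (-(β / (c + 1))) ^ 2 * c + 4 * (-(β / (c + 1))) * β
        = - (β ^ 2 * (3 * c + 4)) / (c + 1) ^ 2 := by
      field_simp; ring
    rw [e] at this
    have : - (β ^ 2 * (3 * c + 4)) / (c + 1) ^ 2 < 0 := by
      apply div_neg_of_neg_of_pos
      · have : 0 < β ^ 2 * (3 * c + 4) := by positivity
        linarith
      · positivity
    linarith
  have := (Finset.sum_eq_zero_iff_of_nonneg (fun i _ => sq_nonneg _)).1 hb0 i (Finset.mem_univ i)
  exact pow_eq_zero_iff (two_ne_zero) |>.1 this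

theorem q_abs (G : SimpleGraph (Fin n)) (x : Fin n → ℝ) :
    bl G (fun k => |x k|) (fun k => |x k|) ≤ bl G x x := by
  simp only [bl, Bv_eq]
  refine Finset.sum_le_sum fun i _ => ?_
  have h1 : x i * ∑ j ∈ nb G i, x j ≤ |x i| * ∑ j ∈ nb G i, |x j| := by
    calc x i * ∑ j ∈ nb G i, x j ≤ |x i * ∑ j ∈ nb G i, x j| := le_abs_self _
      _ = |x i| * |∑ j ∈ nb G i, x j| := abs_mul _ _
      _ ≤ _ := mul_le_mul_of_nonneg_left (Finset.abs_sum_le_sum_abs _ _) (abs_nonneg _)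
  have h2 : |x i| * |x i| = x i * x i := abs_mul_abs_self _
  nlinarith

theorem sum_pos' {h : Fin n → ℝ} (h0 : ∀ i, 0 ≤ h i) (hne : h ≠ 0) : 0 < ∑ i, h i := by
  obtain ⟨i, hi⟩ := Function.ne_iff.1 hne
  exact Finset.sum_pos' (fun i _ => h0 i) ⟨i, Finset.mem_univ i, lt_of_le_of_ne (h0 i) (Ne.symm hi)⟩

theorem nonneg_ker {G : SimpleGraph (Fin n)} (P : PSD G) {h : Fin n → ℝ} (h0 : ∀ i, 0 ≤ h i)
    (hne : h ≠ 0) (hB : ∀ i, Bv G h i = 0) (x : Fin n → ℝ) : 0 ≤ bl G x x := by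
  have hs := sum_pos' h0 hne
  have := P (fun k => 1 * x k + (-((∑ i, x i) / ∑ i, h i)) * h k)
  have e1 : bl G x h = 0 := Finset.sum_eq_zero fun i _ => by rw [hB]; simp
  have e2 : bl G h h = 0 := Finset.sum_eq_zero fun i _ => by rw [hB]; simp
  rw [q_comb, sum_comb, e1, e2] at this
  have e3 : 1 * ∑ k, x k + (-((∑ i, x i) / ∑ i, h i)) * ∑ k, h k = 0 := by
    field_simp; ring
  rw [e3] at this
  linarith

theorem two_vec {G : SimpleGraph (Fin n)} (P : PSD G) {h w : Fin n → ℝ} (h0 : ∀ i, 0 ≤ h i)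
    (hne : h ≠ 0) (w0 : ∀ i, 0 ≤ w i) (wne : w ≠ 0) (hw : bl G h w = 0)
    (hq : bl G h h ≤ 0) (wq : bl G w w ≤ 0) (i : Fin n) :
    (∑ k, w k) * Bv G h i = (∑ k, h k) * Bv G w i := by
  have hs := sum_pos' h0 hne
  have ws := sum_pos' w0 wne
  have e : ∑ k, ((∑ k, w k) * h k + (-(∑ k, h k)) * w k) = 0 := by rw [sum_comb]; ring
  have e2 := q_comb G h w (∑ k, w k) (-(∑ k, h k))
  rw [hw] at e2
  have p := P (fun k => (∑ k, w k) * h k + (-(∑ k, h k)) * w k)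
  rw [e] at p
  have e3 : bl G (fun k => (∑ k, w k) * h k + (-(∑ k, h k)) * w k)
    (fun k => (∑ k, w k) * h k + (-(∑ k, h k)) * w k) = 0 := by
    apply le_antisymm
    · rw [e2]
      have a := mul_nonneg (sq_nonneg (∑ k, w k)) (neg_nonneg.2 hq)
      have b := mul_nonneg (sq_nonneg (∑ k, h k)) (neg_nonneg.2 wq)
      nlinarith
    · linarith
  have := zero_lem P e e3 i
  rw [Bv_comb] at this
  linarith

theorem bl_disj {G : SimpleGraph (Fin n)} {h w : Fin n → ℝ}
    (H : ∀ i, h i ≠ 0 → w i = 0 ∧ ∀ j, G.Adj i j → w j = 0) : bl G h w = 0 := by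
  refine Finset.sum_eq_zero fun i _ => ?_
  by_cases hi : h i = 0
  · simp [hi]
  · obtain ⟨a, b⟩ := H i hi
    rw [Bv_eq, a, Finset.sum_eq_zero fun j hj => b j ((mem_nb G i j).1 hj)]
    simp

theorem master {G : SimpleGraph (Fin n)} (P : PSD G) {x0 : Fin n → ℝ} (hx0 : bl G x0 x0 < 0)
    (hdeg : ∀ v, (nb G v).card ≤ 16)
    {h : Fin n → ℝ} (h0 : ∀ i, 0 ≤ h i) (hne : h ≠ 0) (hq : bl G h h ≤ 0)
    (H Z : Finset (Fin n)) (hH : ∀ i, h i ≠ 0 → i ∈ H)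
    (hN : ∀ i ∈ H, ∀ j, G.Adj i j → j ∈ H ∨ j ∈ Z)
    (hpos : ∀ y : Fin n → ℝ, (∀ i, y i ≠ 0 → i ∈ H ∧ i ∉ Z) → y ≠ 0 → 0 < bl G y y) :
    ∃ F : Finset (Fin n), F.card ≤ Z.card + 17 ∧
      ∀ x, Ker G x → (∀ i ∈ F, x i = 0) → x = 0 := by
  classical
  have hv : ∃ v, Bv G h v ≠ 0 := by
    by_contra hc
    push Not at hc
    exact absurd (nonneg_ker P h0 hne hc x0) (not_le.2 hx0)
  obtain ⟨v, hv⟩ := hv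
  refine ⟨Z ∪ insert v (nb G v), ?_, ?_⟩
  · have := Finset.card_union_le Z (insert v (nb G v))
    have := Finset.card_insert_le v (nb G v)
    have := hdeg v
    omega
  intro x hx hF
  set y : Fin n → ℝ := fun i => if i ∈ H then x i else 0 with hy
  set w : Fin n → ℝ := fun i => if i ∈ H then 0 else x i with hwd
  have hxZ : ∀ i ∈ Z, x i = 0 := fun i hi => hF i (by simp [hi])
  have hxyw : x = fun k => 1 * y k + 1 * w k := by
    funext k
    by_cases hk : k ∈ H <;> simp [hy, hwd, hk]
  have hwn : ∀ i ∈ H, w i = 0 ∧ ∀ j, G.Adj i j → w j = 0 := by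
    intro i hi
    refine ⟨by simp [hwd, hi], fun j hj => ?_⟩
    rcases hN i hi j hj with hj | hj
    · simp [hwd, hj]
    · simp [hwd, hxZ j hj]
  have byw : bl G y w = 0 := bl_disj fun i hi => hwn i (by
    by_contra hc
    exact hi (by simp [hy, hc]))
  have bhw : bl G h (fun k => |w k|) = 0 := bl_disj fun i hi => by
    obtain ⟨a, b⟩ := hwn i (hH i hi)
    exact ⟨by simp [a], fun j hj => by simp [b j hj]⟩
  have hqy : y ≠ 0 → 0 < bl G y y := hpos y (by
    intro i hi
    have hiH : i ∈ H := by
      by_contra hc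
      exact hi (by simp [hy, hc])
    refine ⟨hiH, fun hz => hi ?_⟩
    simp [hy, hxZ i hz])
  have hqw : w ≠ 0 → 0 < bl G w w := by
    intro wne
    refine lt_of_lt_of_le ?_ (q_abs G w)
    by_contra hc
    push Not at hc
    have wne' : (fun k => |w k|) ≠ 0 := by
      intro h'
      apply wne
      funext k
      have := congrFun h' k
      simpa using this
    have e := two_vec P h0 hne (fun i => abs_nonneg _) wne' bhw hq hc v
    have hz : ∀ i ∈ insert v (nb G v), w i = 0 := by
      intro i hi
      have : x i = 0 := hF i (Finset.mem_union_right _ hi)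
      simp [hwd, this]
    have e0 : Bv G (fun k => |w k|) v = 0 := by
      rw [Bv_eq, Finset.sum_eq_zero fun j hj => ?_]
      · simp [hz v (Finset.mem_insert_self _ _)]
      · simp [hz j (Finset.mem_insert_of_mem hj)]
    rw [e0, mul_zero] at e
    rcases mul_eq_zero.1 e with e | e
    · exact absurd e (sum_pos' (fun i => abs_nonneg _) wne').ne'
    · exact hv e
  have hk := hx.q
  have e := q_comb G y w 1 1
  rw [← hxyw, byw] at e
  rw [e] at hk
  have s0 := sq_nonneg (∑ i, x i)
  have y0 : 0 ≤ bl G y y := by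
    by_cases hyz : y = 0
    · rw [hyz]; simp [bl]
    · exact (hqy hyz).le
  have w0 : 0 ≤ bl G w w := by
    by_cases hyz : w = 0
    · rw [hyz]; simp [bl]
    · exact (hqw hyz).le
  have yz : y = 0 := by
    by_contra hc
    have := hqy hc
    nlinarith
  have wz : w = 0 := by
    by_contra hc
    have := hqw hc
    nlinarith
  rw [hxyw, yz, wz]
  funext k; simp

theorem q_nonpos {G : SimpleGraph (Fin n)} {h : Fin n → ℝ} (h0 : ∀ i, 0 ≤ h i)
    (H : ∀ i, h i ≠ 0 → 2 * h i ≤ ∑ j ∈ nb G i, h j) : bl G h h ≤ 0 := by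
  refine Finset.sum_nonpos fun i _ => ?_
  by_cases hi : h i = 0
  · simp [hi]
  · rw [Bv_eq]
    exact mul_nonpos_of_nonneg_of_nonpos (h0 i) (by linarith [H i hi])

/-- version with `Z` the closed neighbourhood of `H`. -/
theorem master' {G : SimpleGraph (Fin n)} (P : PSD G) {x0 : Fin n → ℝ} (hx0 : bl G x0 x0 < 0)
    (hdeg : ∀ v, (nb G v).card ≤ 16) (d : ℕ) (hd : ∀ v, (nb G v).card ≤ d)
    {h : Fin n → ℝ} (h0 : ∀ i, 0 ≤ h i) (hne : h ≠ 0)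
    (hq : ∀ i, h i ≠ 0 → 2 * h i ≤ ∑ j ∈ nb G i, h j)
    (H : Finset (Fin n)) (hH : ∀ i, h i ≠ 0 → i ∈ H) :
    ∃ F : Finset (Fin n), F.card ≤ H.card * (d + 1) + 17 ∧
      ∀ x, Ker G x → (∀ i ∈ F, x i = 0) → x = 0 := by
  classical
  obtain ⟨F, hF, hF'⟩ := master P hx0 hdeg h0 hne (q_nonpos h0 hq) H
    (H.biUnion fun i => insert i (nb G i)) hH
    (fun i hi j hj => Or.inr (Finset.mem_biUnion.2 ⟨i, hi, by simp [mem_nb, hj]⟩))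
    (fun y hy hy0 => by
      exfalso
      apply hy0
      funext i
      by_contra hc
      obtain ⟨a, b⟩ := hy i hc
      exact b (Finset.mem_biUnion.2 ⟨i, a, by simp⟩))
  refine ⟨F, hF.trans ?_, hF'⟩
  have := Finset.card_biUnion_le_card_mul H (fun i => insert i (nb G i)) (d + 1) (fun i _ => by
    have := Finset.card_insert_le i (nb G i)
    have := hd i
    omega)
  omega

end Aux
namespace Aux

variable {n : ℕ}

theorem case_tri {G : SimpleGraph (Fin n)} (P : PSD G) {x0 : Fin n → ℝ} (hx0 : bl G x0 x0 < 0)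
    (hdeg : ∀ v, (nb G v).card ≤ 16) (a b c : Fin n) (hab : G.Adj a b) (hbc : G.Adj b c)
    (hac : G.Adj a c) :
    ∃ F : Finset (Fin n), F.card ≤ 90 ∧ ∀ x, Ker G x → (∀ i ∈ F, x i = 0) → x = 0 := by
  classical
  have key : ∀ u v w : Fin n, G.Adj u v → G.Adj u w → v ≠ w → ∀ h : Fin n → ℝ, (∀ i, 0 ≤ h i) →
      h v + h w ≤ ∑ j ∈ nb G u, h j := by
    intro u v w huv huw hvw h h0
    rw [← Finset.sum_pair hvw]
    refine Finset.sum_le_sum_of_subset_of_nonneg ?_ (fun i _ _ => h0 i)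
    intro i hi
    simp only [Finset.mem_insert, Finset.mem_singleton] at hi
    rcases hi with rfl | rfl <;> simpa [mem_nb]
  set h : Fin n → ℝ := fun i => if i ∈ ({a, b, c} : Finset (Fin n)) then 1 else 0 with hh
  have h0 : ∀ i, 0 ≤ h i := fun i => by simp only [hh]; split_ifs <;> norm_num
  have hmem : ∀ i, h i ≠ 0 → i ∈ ({a, b, c} : Finset (Fin n)) := by
    intro i hi
    by_contra hc
    exact hi (by simp only [hh]; rw [if_neg hc])
  have ha : h a = 1 := by simp [hh]
  have hb : h b = 1 := by simp [hh]
  have hc : h c = 1 := by simp [hh]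
  obtain ⟨F, hF, hF'⟩ := master' P hx0 hdeg 16 hdeg h0
    (fun h' => by have := congrFun h' a; rw [ha] at this; simp at this) (by
      intro i hi
      have := hmem i hi
      simp only [Finset.mem_insert, Finset.mem_singleton] at this
      rcases this with rfl | rfl | rfl
      · have := key i b c hab hac hbc.ne h h0
        linarith
      · have := key i a c hab.symm hbc hac.ne h h0
        linarith
      · have := key i a b hac.symm hbc.symm hab.ne h h0
        linarith) {a, b, c} hmem
  refine ⟨F, hF.trans ?_, hF'⟩
  have : ({a, b, c} : Finset (Fin n)).card ≤ 3 := Finset.card_le_three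
  omega

theorem case_star {G : SimpleGraph (Fin n)} (P : PSD G) {x0 : Fin n → ℝ} (hx0 : bl G x0 x0 < 0)
    (hdeg : ∀ v, (nb G v).card ≤ 16)
    (hT : ∀ a b c, G.Adj a b → G.Adj b c → G.Adj a c → False) (c : Fin n)
    (hc : 4 ≤ (nb G c).card) :
    ∃ F : Finset (Fin n), F.card ≤ 90 ∧ ∀ x, Ker G x → (∀ i ∈ F, x i = 0) → x = 0 := by
  classical
  obtain ⟨L, hL, hL4⟩ := Finset.exists_subset_card_eq hc
  have hLa : ∀ l ∈ L, G.Adj c l := fun l hl => (mem_nb G c l).1 (hL hl)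
  have hcL : c ∉ L := fun h => G.loopless.irrefl c (hLa c h)
  set h : Fin n → ℝ := fun i => if i = c then 2 else if i ∈ L then 1 else 0 with hh
  have hcv : h c = 2 := by simp [hh]
  have hlv : ∀ l ∈ L, h l = 1 := fun l hl => by
    have : l ≠ c := fun e => hcL (e ▸ hl)
    simp [hh, this, hl]
  have h0 : ∀ i, 0 ≤ h i := fun i => by simp only [hh]; split_ifs <;> norm_num
  have hmem : ∀ i, h i ≠ 0 → i ∈ insert c L := by
    intro i hi
    by_contra hc'
    rw [Finset.mem_insert, not_or] at hc'
    exact hi (by simp only [hh]; rw [if_neg hc'.1, if_neg hc'.2])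
  have hq : bl G h h ≤ 0 := by
    apply q_nonpos h0
    intro i hi
    have := hmem i hi
    rcases Finset.mem_insert.1 this with rfl | hl
    · have e : ∑ j ∈ L, h j = 4 := by rw [Finset.sum_congr rfl hlv]; simp [hL4]
      have := Finset.sum_le_sum_of_subset_of_nonneg hL (fun i _ _ => h0 i)
      rw [hcv]; linarith
    · have := Finset.single_le_sum (f := h) (fun i _ => h0 i) ((mem_nb G i c).2 (hLa i hl).symm)
      rw [hlv i hl]; linarith
  obtain ⟨F, hF, hF'⟩ := master P hx0 hdeg h0
    (fun h' => by have := congrFun h' c; rw [hcv] at this; simp at this) hq (insert c L)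
    (insert c ((nb G c \ L) ∪ L.biUnion fun l => (nb G l).erase c)) hmem (by
      intro i hi j hj
      rcases Finset.mem_insert.1 hi with rfl | hl
      · by_cases hjL : j ∈ L
        · left; simp [hjL]
        · right; simp [mem_nb, hj, hjL]
      · by_cases hjc : j = c
        · left; simp [hjc]
        · right
          apply Finset.mem_insert_of_mem
          apply Finset.mem_union_right
          exact Finset.mem_biUnion.2 ⟨i, hl, by simp [mem_nb, hj, hjc]⟩) (by
      intro y hy hy0
      have hyL : ∀ i, y i ≠ 0 → i ∈ L := by
        intro i hi
        obtain ⟨p, q⟩ := hy i hi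
        rcases Finset.mem_insert.1 p with rfl | hl
        · exact absurd (Finset.mem_insert_self _ _) q
        · exact hl
      have e : bl G y y = ∑ i, 2 * (y i * y i) := by
        refine Finset.sum_congr rfl fun i _ => ?_
        by_cases hi : y i = 0
        · simp [hi]
        · rw [Bv_eq, Finset.sum_eq_zero]
          · ring
          · intro j hj
            by_contra hyj
            exact hT c i j (hLa i (hyL i hi)) ((mem_nb G i j).1 hj) (hLa j (hyL j hyj))
      rw [e]
      obtain ⟨i, hi⟩ := Function.ne_iff.1 hy0
      refine Finset.sum_pos' (fun i _ => by nlinarith [mul_self_nonneg (y i)]) ⟨i, Finset.mem_univ i, ?_⟩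
      have := mul_self_pos.2 hi
      linarith)
  refine ⟨F, hF.trans ?_, hF'⟩
  have c1 := Finset.card_biUnion_le_card_mul L (fun l => (nb G l).erase c) 15 (fun l hl => by
    have := hdeg l
    rw [Finset.card_erase_of_mem ((mem_nb G l c).2 (hLa l hl).symm)]
    omega)
  have c2 := Finset.card_sdiff_of_subset hL
  have c3 := Finset.card_union_le (nb G c \ L) (L.biUnion fun l => (nb G l).erase c)
  have c4 := Finset.card_insert_le c ((nb G c \ L) ∪ L.biUnion fun l => (nb G l).erase c)
  have := hdeg c
  rw [hL4] at c1 c2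
  omega

/-- Two vertices of degree three, joined through a small core. -/
theorem case_core {G : SimpleGraph (Fin n)} (P : PSD G) {x0 : Fin n → ℝ} (hx0 : bl G x0 x0 < 0)
    (hdeg : ∀ v, (nb G v).card ≤ 3) (u w : Fin n) (K : Finset (Fin n)) (huK : u ∈ K) (hwK : w ∈ K)
    (hK3 : K.card ≤ 3)
    (hK : ∀ k ∈ K, ((k = u ∨ k = w) ∧ (nb G k).card = 3 ∧ ∃ p ∈ K, G.Adj k p) ∨
      (∃ p ∈ K, ∃ r ∈ K, p ≠ r ∧ G.Adj k p ∧ G.Adj k r)) :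
    ∃ F : Finset (Fin n), F.card ≤ 90 ∧ ∀ x, Ker G x → (∀ i ∈ F, x i = 0) → x = 0 := by
  classical
  set U : Finset (Fin n) := nb G u ∪ nb G w with hU
  set h : Fin n → ℝ := fun i => if i ∈ K then 2 else if i ∈ U then 1 else 0 with hh
  have hKv : ∀ k ∈ K, h k = 2 := fun k hk => by simp [hh, hk]
  have hUv : ∀ k ∈ U, 1 ≤ h k := fun k hk => by
    simp only [hh, hk]; split_ifs <;> norm_num
  have h0 : ∀ i, 0 ≤ h i := fun i => by simp only [hh]; split_ifs <;> norm_num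
  have hmem : ∀ i, h i ≠ 0 → i ∈ K ∪ U := by
    intro i hi
    by_contra hc'
    rw [Finset.mem_union, not_or] at hc'
    exact hi (by simp only [hh]; rw [if_neg hc'.1, if_neg hc'.2])
  obtain ⟨F, hF, hF'⟩ := master' P hx0 (fun v => (hdeg v).trans (by norm_num)) 3 hdeg h0
    (fun h' => by have := congrFun h' u; rw [hKv u huK] at this; simp at this) (by
    intro i hi
    by_cases hiK : i ∈ K
    · rw [hKv i hiK]
      rcases hK i hiK with ⟨huw, h3, p, hp, hip⟩ | ⟨p, hp, r, hr, hpr, hip, hir⟩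
      · have hsub : nb G i ⊆ U := by
          rcases huw with rfl | rfl
          · exact Finset.subset_union_left
          · exact Finset.subset_union_right
        have hpi := (mem_nb G i p).2 hip
        rw [← Finset.add_sum_erase _ _ hpi, hKv p hp]
        have : ((nb G i).erase p).card • (1 : ℝ) ≤ ∑ j ∈ (nb G i).erase p, h j :=
          Finset.card_nsmul_le_sum _ _ _ fun j hj => hUv j (hsub (Finset.mem_of_mem_erase hj))
        rw [Finset.card_erase_of_mem hpi, h3] at this
        norm_num at this
        linarith
      · have : ∑ j ∈ ({p, r} : Finset (Fin n)), h j ≤ ∑ j ∈ nb G i, h j := by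
          refine Finset.sum_le_sum_of_subset_of_nonneg ?_ (fun i _ _ => h0 i)
          intro j hj
          simp only [Finset.mem_insert, Finset.mem_singleton] at hj
          rcases hj with rfl | rfl <;> simpa [mem_nb]
        rw [Finset.sum_pair hpr, hKv p hp, hKv r hr] at this
        linarith
    · have hiU : i ∈ U := (Finset.mem_union.1 (hmem i hi)).resolve_left hiK
      have hi1 : h i = 1 := by simp [hh, hiK, hiU]
      rw [hi1]
      rcases Finset.mem_union.1 hiU with hu | hu
      · have := Finset.single_le_sum (f := h) (fun i _ => h0 i)
          ((mem_nb G i u).2 ((mem_nb G u i).1 hu).symm)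
        rw [hKv u huK] at this; linarith
      · have := Finset.single_le_sum (f := h) (fun i _ => h0 i)
          ((mem_nb G i w).2 ((mem_nb G w i).1 hu).symm)
        rw [hKv w hwK] at this; linarith) (K ∪ U) hmem
  refine ⟨F, hF.trans ?_, hF'⟩
  have c1 := Finset.card_union_le K U
  have c2 := Finset.card_union_le (nb G u) (nb G w)
  rw [← hU] at c2
  have := hdeg u
  have := hdeg w
  omega

theorem case_D {G : SimpleGraph (Fin n)} (P : PSD G) {x0 : Fin n → ℝ} (hx0 : bl G x0 x0 < 0)
    {x : Fin n → ℝ} (hx : Ker G x) (hD : ∀ i, 3 ≤ (nb G i).card → x i = 0) : x = 0 := by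
  classical
  have e : bl G x x = ∑ i, (2 - (nb G i).card) * (x i) ^ 2
      + (∑ i, ∑ j, if G.Adj i j then (x i - x j) ^ 2 else 0) / 2 := by
    have e1 : ∀ i, ((nb G i).card : ℝ) * (x i) ^ 2 = ∑ j, if G.Adj i j then (x i) ^ 2 else 0 := by
      intro i
      rw [← Finset.sum_filter, Finset.sum_const, nsmul_eq_mul]; rfl
    have e2 : (∑ i, ∑ j, if G.Adj i j then (x j) ^ 2 else 0)
        = ∑ i, ∑ j, if G.Adj i j then (x i) ^ 2 else 0 := by
      rw [Finset.sum_comm]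
      simp only [G.adj_comm]
    have e3 : (∑ i, ∑ j, if G.Adj i j then (x i - x j) ^ 2 else 0)
        = (∑ i, ∑ j, if G.Adj i j then (x i) ^ 2 else 0)
        + (∑ i, ∑ j, if G.Adj i j then (x j) ^ 2 else 0)
        - 2 * ∑ i, ∑ j, if G.Adj i j then x i * x j else 0 := by
      simp only [Finset.mul_sum, ← Finset.sum_add_distrib, ← Finset.sum_sub_distrib]
      refine Finset.sum_congr rfl fun i _ => Finset.sum_congr rfl fun j _ => ?_
      split_ifs <;> ring
    have e4 : bl G x x = ∑ i, 2 * (x i) ^ 2 - ∑ i, ∑ j, if G.Adj i j then x i * x j else 0 := by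
      simp only [bl, Bv, ← Finset.sum_sub_distrib]
      refine Finset.sum_congr rfl fun i _ => ?_
      rw [mul_sub, Finset.mul_sum]
      congr 1
      · ring
      · exact Finset.sum_congr rfl fun j _ => by split_ifs <;> simp
    rw [e4, e3, e2]
    simp only [sub_mul, e1, Finset.sum_sub_distrib]
    ring
  have hk := hx.q
  have s0 := sq_nonneg (∑ i, x i)
  have t1 : ∀ i, 0 ≤ (2 - ((nb G i).card : ℝ)) * (x i) ^ 2 := by
    intro i
    by_cases hi : 3 ≤ (nb G i).card
    · simp [hD i hi]
    · have : ((nb G i).card : ℝ) ≤ 2 := by exact_mod_cast (by omega : (nb G i).card ≤ 2)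
      exact mul_nonneg (by linarith) (sq_nonneg _)
  have t2 : ∀ i j, 0 ≤ (if G.Adj i j then (x i - x j) ^ 2 else 0) := by
    intro i j; split_ifs <;> positivity
  have T1 := Finset.sum_nonneg fun i (_ : i ∈ Finset.univ) => t1 i
  have T2 := Finset.sum_nonneg fun i (_ : i ∈ Finset.univ) =>
    Finset.sum_nonneg fun j (_ : j ∈ Finset.univ) => t2 i j
  have z1 : ∑ i, (2 - ((nb G i).card : ℝ)) * (x i) ^ 2 = 0 := by linarith
  have z2 : (∑ i, ∑ j, if G.Adj i j then (x i - x j) ^ 2 else 0) = 0 := by linarith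
  have a1 : ∀ i, (2 - ((nb G i).card : ℝ)) * (x i) ^ 2 = 0 := fun i =>
    (Finset.sum_eq_zero_iff_of_nonneg (fun i _ => t1 i)).1 z1 i (Finset.mem_univ i)
  have a2 : ∀ i j, G.Adj i j → x j = x i := by
    intro i j hij
    have := (Finset.sum_eq_zero_iff_of_nonneg (fun i _ =>
      Finset.sum_nonneg fun j (_ : j ∈ Finset.univ) => t2 i j)).1 z2 i (Finset.mem_univ i)
    have := (Finset.sum_eq_zero_iff_of_nonneg (fun j _ => t2 i j)).1 this j (Finset.mem_univ j)
    rw [if_pos hij] at this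
    have := pow_eq_zero_iff (two_ne_zero) |>.1 this
    linarith
  by_contra hne
  have hne' : (fun k => |x k|) ≠ 0 := by
    intro h'
    apply hne
    funext k
    simpa using congrFun h' k
  refine absurd (nonneg_ker P (fun i => abs_nonneg (x i)) hne' ?_ x0) (not_le.2 hx0)
  intro i
  rw [Bv_eq, Finset.sum_congr rfl fun j hj => by rw [a2 i j ((mem_nb G i j).1 hj)]]
  rw [Finset.sum_const, nsmul_eq_mul]
  rcases mul_eq_zero.1 (a1 i) with h | h
  · rw [← sub_mul, h, zero_mul]
  · rw [pow_eq_zero_iff (two_ne_zero) |>.1 h]; simp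

theorem nonpsd {G : SimpleGraph (Fin n)} (P : PSD G) {x0 : Fin n → ℝ} (hx0 : bl G x0 x0 < 0)
    (hdeg : ∀ v, (nb G v).card ≤ 16) (hn : 277 ≤ n) :
    ∃ F : Finset (Fin n), 3 * (F.card + 1) ≤ n ∧
      ∀ x, Ker G x → (∀ i ∈ F, x i = 0) → x = 0 := by
  classical
  suffices h : (∃ F : Finset (Fin n), F.card ≤ 90 ∧
      ∀ x, Ker G x → (∀ i ∈ F, x i = 0) → x = 0) ∨ (∃ F : Finset (Fin n), 3 * (F.card + 1) ≤ n ∧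
      ∀ x, Ker G x → (∀ i ∈ F, x i = 0) → x = 0) by
    rcases h with ⟨F, h1, h2⟩ | h
    · exact ⟨F, by omega, h2⟩
    · exact h
  by_cases hT : ∀ a b c, G.Adj a b → G.Adj b c → G.Adj a c → False
  swap
  · push Not at hT
    obtain ⟨a, b, c, h1, h2, h3, -⟩ := hT
    exact Or.inl (case_tri P hx0 hdeg a b c h1 h2 h3)
  by_cases h4 : ∃ c, 4 ≤ (nb G c).card
  · obtain ⟨c, hc⟩ := h4
    exact Or.inl (case_star P hx0 hdeg hT c hc)
  have h3 : ∀ v, (nb G v).card ≤ 3 := by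
    intro v
    by_contra hc
    exact h4 ⟨v, by omega⟩
  set D : Finset (Fin n) := Finset.univ.filter fun i => 3 ≤ (nb G i).card with hD
  by_cases hDn : 3 * (D.card + 1) ≤ n
  · exact Or.inr ⟨D, hDn, fun x hx hx' => case_D P hx0 hx fun i hi => hx' i (by simp [hD, hi])⟩
  left
  have hex : ∃ u ∈ D, ∃ w ∈ D, u ≠ w ∧ ¬ Disjoint (insert u (nb G u)) (insert w (nb G w)) := by
    by_contra hc
    push Not at hc
    have hdis : (D.biUnion fun u => insert u (nb G u)).card = ∑ u ∈ D, (insert u (nb G u)).card :=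
      Finset.card_biUnion fun u hu w hw huw => hc u hu w hw huw
    have h4 : ∑ u ∈ D, (insert u (nb G u)).card = ∑ u ∈ D, 4 := by
      refine Finset.sum_congr rfl fun u hu => ?_
      have : 3 ≤ (nb G u).card := (Finset.mem_filter.1 hu).2
      rw [Finset.card_insert_of_notMem (by simp [mem_nb])]
      have := h3 u
      omega
    have := Finset.card_le_univ (D.biUnion fun u => insert u (nb G u))
    rw [hdis, h4, Finset.sum_const, smul_eq_mul, Fintype.card_fin] at this
    omega
  obtain ⟨u, hu, w, hw, huw, hnd⟩ := hex
  have hu3 : (nb G u).card = 3 := le_antisymm (h3 u) (Finset.mem_filter.1 hu).2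
  have hw3 : (nb G w).card = 3 := le_antisymm (h3 w) (Finset.mem_filter.1 hw).2
  have hadj : G.Adj u w → ∃ F : Finset (Fin n), F.card ≤ 90 ∧
      ∀ x, Ker G x → (∀ i ∈ F, x i = 0) → x = 0 := by
    intro h
    refine case_core P hx0 h3 u w {u, w} (by simp) (by simp) (Finset.card_le_two.trans (by norm_num)) ?_
    intro k hk
    simp only [Finset.mem_insert, Finset.mem_singleton] at hk
    left
    rcases hk with rfl | rfl
    · exact ⟨Or.inl rfl, hu3, w, by simp, h⟩
    · exact ⟨Or.inr rfl, hw3, u, by simp, h.symm⟩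
  rw [Finset.not_disjoint_iff] at hnd
  obtain ⟨p, hp1, hp2⟩ := hnd
  rw [Finset.mem_insert, mem_nb] at hp1 hp2
  rcases hp1 with rfl | hp1
  · rcases hp2 with rfl | hp2
    · exact absurd rfl huw
    · exact hadj hp2.symm
  rcases hp2 with rfl | hp2
  · exact hadj hp1
  refine case_core P hx0 h3 u w {u, p, w} (by simp) (by simp) Finset.card_le_three ?_
  intro k hk
  simp only [Finset.mem_insert, Finset.mem_singleton] at hk
  rcases hk with rfl | rfl | rfl
  · exact Or.inl ⟨Or.inl rfl, hu3, p, by simp, hp1⟩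
  · exact Or.inr ⟨u, by simp, w, by simp, huw, hp1.symm, hp2.symm⟩
  · exact Or.inl ⟨Or.inr rfl, hw3, p, by simp, hp2⟩

/-! The positive semidefinite case. -/

theorem Bv_abs_zero {G : SimpleGraph (Fin n)} (Q : ∀ x, 0 ≤ bl G x x) {x : Fin n → ℝ}
    (hx : bl G x x = 0) (i : Fin n) : Bv G (fun k => |x k|) i = 0 := by
  have P : PSD G := fun x => by have := Q x; positivity
  have h1 : bl G (fun k => |x k|) (fun k => |x k|) = 0 :=
    le_antisymm ((q_abs G x).trans hx.le) (Q _)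
  -- use the same quadratic argument, with the form itself
  set z : Fin n → ℝ := fun k => |x k| with hz
  set y : Fin n → ℝ := fun i => Bv G z i with hy
  set β : ℝ := ∑ i, (Bv G z i) ^ 2 with hβ
  have hb : bl G z y = β := by
    rw [bl_symm, hβ, bl]
    exact Finset.sum_congr rfl fun i _ => by simp [hy, sq]
  have h0 : 0 ≤ β := Finset.sum_nonneg fun i _ => sq_nonneg _
  have hb0 : β = 0 := by
    by_contra hne
    have hp : 0 < β := lt_of_le_of_ne h0 (Ne.symm hne)
    have c0 := Q y
    have := Q (fun k => (bl G y y + 1) * z k + (-β) * y k)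
    rw [q_comb, h1, hb] at this
    nlinarith [mul_pos hp hp, mul_nonneg (mul_pos hp hp).le c0]
  have := (Finset.sum_eq_zero_iff_of_nonneg (fun i _ => sq_nonneg _)).1 hb0 i (Finset.mem_univ i)
  exact pow_eq_zero_iff (two_ne_zero) |>.1 this

theorem zero_adj {G : SimpleGraph (Fin n)} (Q : ∀ x, 0 ≤ bl G x x) {x : Fin n → ℝ}
    (hx : bl G x x = 0) {i j : Fin n} (hij : G.Adj i j) (hi : x i = 0) : x j = 0 := by
  have := Bv_abs_zero Q hx i
  rw [Bv_eq, hi] at this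
  have h : ∑ j ∈ nb G i, |x j| = 0 := by simpa using this
  have := (Finset.sum_eq_zero_iff_of_nonneg (fun j _ => abs_nonneg _)).1 h j ((mem_nb G i j).2 hij)
  simpa using this

theorem zero_reach {G : SimpleGraph (Fin n)} (Q : ∀ x, 0 ≤ bl G x x) {x : Fin n → ℝ}
    (hx : bl G x x = 0) {i j : Fin n} (hij : G.Reachable i j) (hi : x i = 0) : x j = 0 := by
  obtain ⟨p⟩ := hij
  induction p with
  | nil => exact hi
  | cons h p ih => exact ih (zero_adj Q hx h hi)

theorem three {G : SimpleGraph (Fin n)} (Q : ∀ x, 0 ≤ bl G x x) {x : Fin n → ℝ}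
    (hx : bl G x x = 0) {i : Fin n} (hi : x i ≠ 0) :
    ∃ s : Finset (Fin n), s.card = 3 ∧ ∀ j ∈ s, G.Reachable i j := by
  classical
  have hB := Bv_abs_zero Q hx
  simp only [Bv_eq] at hB
  have hp : 0 < |x i| := abs_pos.2 hi
  obtain ⟨j, hj⟩ : (nb G i).Nonempty := by
    rw [Finset.nonempty_iff_ne_empty]
    intro h
    have := hB i
    rw [h] at this
    simp at this
    exact hi this
  have hij := (mem_nb G i j).1 hj
  by_cases h1 : ∃ k, G.Adj i k ∧ k ≠ j
  · obtain ⟨k, hk, hkj⟩ := h1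
    refine ⟨{i, j, k}, Finset.card_eq_three.2 ⟨i, j, k, hij.ne, hk.ne, hkj.symm, rfl⟩, ?_⟩
    intro l hl
    simp only [Finset.mem_insert, Finset.mem_singleton] at hl
    rcases hl with rfl | rfl | rfl
    · exact SimpleGraph.Reachable.refl _
    · exact hij.reachable
    · exact hk.reachable
  by_cases h2 : ∃ k, G.Adj j k ∧ k ≠ i
  · obtain ⟨k, hk, hki⟩ := h2
    refine ⟨{i, j, k}, Finset.card_eq_three.2 ⟨i, j, k, hij.ne, hki.symm, hk.ne, rfl⟩, ?_⟩
    intro l hl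
    simp only [Finset.mem_insert, Finset.mem_singleton] at hl
    rcases hl with rfl | rfl | rfl
    · exact SimpleGraph.Reachable.refl _
    · exact hij.reachable
    · exact hij.reachable.trans hk.reachable
  exfalso
  have n1 : nb G i = {j} := by
    ext k
    rw [mem_nb, Finset.mem_singleton]
    constructor
    · intro hk
      by_contra hne
      exact h1 ⟨k, hk, hne⟩
    · rintro rfl; exact hij
  have n2 : nb G j = {i} := by
    ext k
    rw [mem_nb, Finset.mem_singleton]
    constructor
    · intro hk
      by_contra hne
      exact h2 ⟨k, hk, hne⟩
    · rintro rfl; exact hij.symm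
  have b1 := hB i
  have b2 := hB j
  rw [n1, Finset.sum_singleton] at b1
  rw [n2, Finset.sum_singleton] at b2
  linarith

theorem psd {G : SimpleGraph (Fin n)} (Q : ∀ x, 0 ≤ bl G x x) (hn : 277 ≤ n) :
    ∃ F : Finset (Fin n), 3 * (F.card + 1) ≤ n ∧
      ∀ x, Ker G x → (∀ i ∈ F, x i = 0) → x = 0 := by
  classical
  have P : PSD G := fun x => by have := Q x; positivity
  have hker : ∀ x, Ker G x → ∑ i, x i = 0 ∧ bl G x x = 0 := by
    intro x hx
    have := hx.q
    have := Q x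
    have s0 := sq_nonneg (∑ i, x i)
    exact ⟨pow_eq_zero_iff (two_ne_zero) |>.1 (by linarith), by linarith⟩
  set sp : G.ConnectedComponent → Finset (Fin n) := fun c =>
    Finset.univ.filter fun i => G.connectedComponentMk i = c with hsp
  set C : Finset G.ConnectedComponent := Finset.univ.filter fun c => 3 ≤ (sp c).card with hC
  set rep : G.ConnectedComponent → Fin n := fun c => Quot.out c with hrep
  have hrepr : ∀ c, G.connectedComponentMk (rep c) = c := fun c => Quot.out_eq c
  have hC3 : 3 * C.card ≤ n := by
    have h1 : (C.biUnion sp).card = ∑ c ∈ C, (sp c).card := by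
      apply Finset.card_biUnion
      intro c _ d _ hcd
      refine Finset.disjoint_left.2 ?_
      intro i hi hi'
      exact hcd ((Finset.mem_filter.1 hi).2.symm.trans (Finset.mem_filter.1 hi').2)
    have h2 : C.card • 3 ≤ ∑ c ∈ C, (sp c).card :=
      Finset.card_nsmul_le_sum _ _ _ fun c hc => (Finset.mem_filter.1 hc).2
    have h3 := Finset.card_le_univ (C.biUnion sp)
    rw [Fintype.card_fin] at h3
    rw [smul_eq_mul] at h2
    omega
  have inj : ∀ x, bl G x x = 0 → (∀ c ∈ C, x (rep c) = 0) → x = 0 := by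
    intro x hx hz
    funext i
    by_contra hi
    obtain ⟨s, hs, hs'⟩ := three Q hx hi
    have hc : G.connectedComponentMk i ∈ C := by
      simp only [hC, Finset.mem_filter, Finset.mem_univ, true_and]
      rw [← hs]
      apply Finset.card_le_card
      intro j hj
      simp only [hsp, Finset.mem_filter, Finset.mem_univ, true_and]
      exact SimpleGraph.ConnectedComponent.sound (hs' j hj).symm
    have hr : G.Reachable (rep (G.connectedComponentMk i)) i :=
      SimpleGraph.ConnectedComponent.exact (hrepr _)
    exact hi (zero_reach Q hx hr (hz _ hc))
  rcases C.eq_empty_or_nonempty with hCe | ⟨c0, hc0⟩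
  · refine ⟨∅, by simp; omega, fun x hx _ => inj x (hker x hx).2 ?_⟩
    rw [hCe]; simp
  refine ⟨(C.erase c0).image rep, ?_, ?_⟩
  · have h1 := Finset.card_image_le (s := C.erase c0) (f := rep)
    rw [Finset.card_erase_of_mem hc0] at h1
    have : 0 < C.card := Finset.card_pos.2 ⟨c0, hc0⟩
    omega
  intro x hx hF
  obtain ⟨hs, hq⟩ := hker x hx
  have hBx := zero_lem P hs hq
  have hBa := Bv_abs_zero Q hq
  obtain ⟨t, ht, ht'⟩ : ∃ t : ℝ, (t = 1 ∨ t = -1) ∧ x (rep c0) = t * |x (rep c0)| := by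
    rcases abs_cases (x (rep c0)) with ⟨h, -⟩ | ⟨h, -⟩
    · exact ⟨1, Or.inl rfl, by rw [h]; ring⟩
    · exact ⟨-1, Or.inr rfl, by rw [h]; ring⟩
  have hz := inj (fun k => 1 * x k + (-t) * |x k|) (by
    refine Finset.sum_eq_zero fun i _ => ?_
    rw [Bv_comb, hBx, hBa]; simp) (by
    intro c hc
    by_cases h : c = c0
    · subst h; linarith
    · have := hF (rep c) (Finset.mem_image_of_mem _ (Finset.mem_erase.2 ⟨h, hc⟩))
      simp [this])
  have e := sum_comb x (fun k => |x k|) 1 (-t)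
  rw [hs] at e
  have e0 : ∑ k, (1 * x k + (-t) * |x k|) = 0 := Finset.sum_eq_zero fun k _ => congrFun hz k
  rw [e0] at e
  have : ∑ k, |x k| = 0 := by
    rcases ht with rfl | rfl <;> linarith
  funext k
  have := (Finset.sum_eq_zero_iff_of_nonneg (fun j _ => abs_nonneg _)).1 this k (Finset.mem_univ k)
  simpa using this

theorem main {G : SimpleGraph (Fin n)} (P : PSD G)
    (hdeg : ∀ v, (nb G v).card ≤ 16) (hn : 277 ≤ n) :
    ∃ F : Finset (Fin n), 3 * (F.card + 1) ≤ n ∧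
      ∀ x, Ker G x → (∀ i ∈ F, x i = 0) → x = 0 := by
  by_cases h : ∀ x, 0 ≤ bl G x x
  · exact psd h hn
  · push Not at h
    obtain ⟨x0, hx0⟩ := h
    exact nonpsd P hx0 hdeg hn

theorem seidel_mulVec (G : SimpleGraph (Fin n)) (x : Fin n → ℝ) (i : Fin n) :
    ((seidelOf G + (5 : ℝ) • (1 : Matrix (Fin n) (Fin n) ℝ)) *ᵥ x) i = ∑ k, x k + 2 * Bv G x i := by
  classical
  have h : ∀ j, (seidelOf G + (5 : ℝ) • (1 : Matrix (Fin n) (Fin n) ℝ)) i j * x j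
      = x j + (if i = j then 4 * x j else 0) - 2 * (if G.Adj i j then x j else 0) := by
    intro j
    simp only [seidelOf, Matrix.add_apply, Matrix.of_apply, Matrix.smul_apply, Matrix.one_apply]
    by_cases hij : i = j
    · subst hij; simp; ring
    · by_cases ha : G.Adj i j <;> simp [hij, ha]; ring
  simp only [Matrix.mulVec, dotProduct, h, Bv]
  rw [Finset.sum_sub_distrib, Finset.sum_add_distrib, Finset.sum_ite_eq, ← Finset.mul_sum]
  simp
  ring

theorem shift_posSemidef {S : Matrix (Fin n) (Fin n) ℝ} (hS : IsSeidel S) (hmin : minEig S = -5) :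
    (S + (5 : ℝ) • (1 : Matrix (Fin n) (Fin n) ℝ)).PosSemidef := by
  have hA : S.IsHermitian := by
    rw [Matrix.IsHermitian, Matrix.conjTranspose_eq_transpose_of_trivial]; exact hS.1
  have hB : (S + (5 : ℝ) • (1 : Matrix (Fin n) (Fin n) ℝ)).IsHermitian := by
    rw [Matrix.IsHermitian, Matrix.conjTranspose_eq_transpose_of_trivial]
    simp [hS.1.eq]
  have hge : ∀ i, -5 ≤ hA.eigenvalues i := by
    intro i
    rw [← hmin, minEig, dif_pos hA]
    exact ciInf_le (Set.finite_range _).bddBelow i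
  rw [hB.posSemidef_iff_eigenvalues_nonneg]
  intro i
  have h1 := hB.eigenvalues_mem_spectrum_real i
  have h2 : hB.eigenvalues i - 5 ∈ spectrum ℝ S := by
    rw [spectrum.mem_iff] at h1 ⊢
    convert h1 using 2
    rw [map_sub, Algebra.algebraMap_eq_smul_one (5 : ℝ)]
    abel
  rw [hA.spectrum_real_eq_range_eigenvalues] at h2
  obtain ⟨j, hj⟩ := h2
  have := hge j
  simp only [Pi.zero_apply]
  linarith

end Aux
/-- If `S` is a Seidel matrix of order `n ≥ 277` with smallest eigenvalue
exactly `-5` whose switching class contains a graph `G` of maximum degree at most `16`,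
then `rk(S + 5I) ≥ 2n/3 + 1`. -/
theorem stmt_8 {n : ℕ} (S : Matrix (Fin n) (Fin n) ℝ) (hS : IsSeidel S)
    (hmin : minEig S = -5) (hn : 277 ≤ n)
    (G : SimpleGraph (Fin n)) (hsw : SwEquiv S (seidelOf G))
    (hdeg : ∀ v, (G.neighborSet v).ncard ≤ 16) :
    2 * (n : ℝ) / 3 + 1 ≤ ((S + (5 : ℝ) • 1).rank : ℝ) := by
  classical
  obtain ⟨ε, hε, hT⟩ := hsw
  have hεε : ∀ i, ε i * ε i = 1 := fun i => by rcases hε i with h | h <;> rw [h] <;> norm_num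
  have hDD : Matrix.diagonal ε * Matrix.diagonal ε = (1 : Matrix (Fin n) (Fin n) ℝ) := by
    rw [Matrix.diagonal_mul_diagonal]
    simp only [hεε]
    exact Matrix.diagonal_one
  have hTM : seidelOf G + (5 : ℝ) • (1 : Matrix (Fin n) (Fin n) ℝ)
      = Matrix.diagonal ε * (S + (5 : ℝ) • 1) * Matrix.diagonal ε := by
    rw [mul_add, add_mul, ← hT]
    simp [hDD]
  have hunit : IsUnit (Matrix.diagonal ε).det := by
    rw [← Matrix.isUnit_iff_isUnit_det]
    exact IsUnit.of_mul_eq_one _ hDD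
  have hrank : (seidelOf G + (5 : ℝ) • (1 : Matrix (Fin n) (Fin n) ℝ)).rank
      = (S + (5 : ℝ) • (1 : Matrix (Fin n) (Fin n) ℝ)).rank := by
    rw [hTM, Matrix.rank_mul_eq_left_of_isUnit_det _ _ hunit,
      Matrix.rank_mul_eq_right_of_isUnit_det _ _ hunit]
  have hps : (seidelOf G + (5 : ℝ) • (1 : Matrix (Fin n) (Fin n) ℝ)).PosSemidef := by
    rw [hTM]
    have := (Aux.shift_posSemidef hS hmin).mul_mul_conjTranspose_same (Matrix.diagonal ε)
    simpa [Matrix.diagonal_conjTranspose] using this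
  have P : Aux.PSD G := by
    intro x
    have := hps.dotProduct_mulVec_nonneg x
    have e : star x ⬝ᵥ ((seidelOf G + (5 : ℝ) • (1 : Matrix (Fin n) (Fin n) ℝ)) *ᵥ x)
        = (∑ i, x i) ^ 2 + 2 * Aux.bl G x x := by
      simp only [dotProduct, Aux.seidel_mulVec, Aux.bl, sq, Finset.sum_mul, Finset.mul_sum,
        ← Finset.sum_add_distrib, Pi.star_apply, star_trivial]
      refine Finset.sum_congr rfl fun i _ => ?_
      rw [mul_add, Finset.mul_sum]
      ring_nf
    rwa [e] at this
  have hdeg' : ∀ v, (Aux.nb G v).card ≤ 16 := by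
    intro v
    refine le_trans (le_of_eq ?_) (hdeg v)
    rw [← Set.ncard_coe_finset]
    congr 1
    ext j
    simp [Aux.mem_nb]
  obtain ⟨F, hF, hinj⟩ := Aux.main P hdeg' hn
  set L := (seidelOf G + (5 : ℝ) • (1 : Matrix (Fin n) (Fin n) ℝ)).mulVecLin with hL
  have hrn := L.finrank_range_add_finrank_ker
  have hk : Module.finrank ℝ (LinearMap.ker L) ≤ F.card := by
    let f : LinearMap.ker L →ₗ[ℝ] (F → ℝ) :=
      (LinearMap.funLeft ℝ ℝ (fun i : F => (i : Fin n))).comp (LinearMap.ker L).subtype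
    have hf : Function.Injective f := by
      rw [← LinearMap.ker_eq_bot, LinearMap.ker_eq_bot']
      intro x hx
      apply Subtype.ext
      refine hinj x.1 ?_ ?_
      · intro i
        rw [← Aux.seidel_mulVec]
        exact congrFun (LinearMap.mem_ker.1 x.2) i
      · intro i hi
        exact congrFun hx ⟨i, hi⟩
    have := LinearMap.finrank_le_finrank_of_injective hf
    simpa using this
  have hr : (S + (5 : ℝ) • (1 : Matrix (Fin n) (Fin n) ℝ)).rank
      = Module.finrank ℝ (LinearMap.range L) := by
    rw [← hrank]; rfl
  rw [Module.finrank_fin_fun] at hrn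
  have h3 : 2 * n + 3 ≤ 3 * (S + (5 : ℝ) • (1 : Matrix (Fin n) (Fin n) ℝ)).rank := by
    rw [hr]; omega
  have h3' : 2 * (n : ℝ) + 3 ≤ 3 * ((S + (5 : ℝ) • (1 : Matrix (Fin n) (Fin n) ℝ)).rank : ℝ) := by
    exact_mod_cast h3
  linarith
end
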